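/- Let G ≤ GL_n(F) be a finite group with polynomial ring of invariants such that b_H = n−1 for every reflecting hyperplane H (every transvection root space is maximal). If ω₁,...,ωₙ are invariant 1-forms with ω₁ ∧ ... ∧ ωₙ = c·Q(Ã)·Q_det·vol (c ∈ F^×), then the forms ω_I := (ω_{i₁}∧...∧ω_{i_k})/δ(𝒜_{n−1})^{k−1}, over all ordered index sets I = {i₁<...<i_k}, form a basis of (Ω^k)^G as a free F[V]^G-module; hence Ω^G is a free exterior algebra over F[V]^G on ω₁,...,ωₙ under the twisted wedge (μ,ν) ↦ (μ∧ν)/δ(𝒜_{n−1}). -/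

import Mathlib

open MvPolynomial

abbrev GLn (F : Type*) [Field F] (n : ℕ) := (Fin n → F) ≃ₗ[F] (Fin n → F)

variable {F : Type*} [Field F] {n : ℕ}

/-- Matrix of the contragredient action of `g` on the coordinate functions:
`g · z_i = ∑ j (actMat g i j) z_j`. -/
noncomputable def actMat (g : GLn F n) : Matrix (Fin n) (Fin n) F :=
  Matrix.of fun i j => g.symm (Pi.single j 1) i

/-- Action of `g ∈ GL(V)` on polynomials `F[V]` (contragredient action). -/
noncomputable def polyAct (g : GLn F n) : MvPolynomial (Fin n) F →ₐ[F] MvPolynomial (Fin n) F :=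
  aeval fun i => ∑ j, C (actMat g i j) * X j

/-- The degree-one polynomial corresponding to a linear form on `V`. -/
noncomputable def linToPoly (z : (Fin n → F) →ₗ[F] F) : MvPolynomial (Fin n) F :=
  ∑ j, C (z (Pi.single j 1)) * X j

/-- The invariant ring `F[V]^G` as a subalgebra of `F[V]`. -/
noncomputable def invSub (G : Subgroup (GLn F n)) : Subalgebra F (MvPolynomial (Fin n) F) where
  carrier := {f | ∀ g ∈ G, polyAct g f = f}
  add_mem' := fun {a b} ha hb g hg => by rw [map_add, ha g hg, hb g hg]
  mul_mem' := fun {a b} ha hb g hg => by rw [map_mul, ha g hg, hb g hg]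
  algebraMap_mem' := fun r g hg => (polyAct g).commutes r

/-- Action of `g` on a differential 1-form `ω = ∑ i (w i) dz_i`; the result is the
coefficient vector of `g · ω`. -/
noncomputable def oneFormAct (g : GLn F n) (w : Fin n → MvPolynomial (Fin n) F) :
    Fin n → MvPolynomial (Fin n) F :=
  fun j => ∑ i, polyAct g (w i) * C (actMat g i j)

/-- The coefficient of `dz_J` in `g · dz_I` (a minor determinant of `actMat g`). -/
noncomputable def minorDet (g : GLn F n) (I J : Finset (Fin n)) : F :=
  if h : J.card = I.card then
    Matrix.det (Matrix.of fun a b : Fin I.card =>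
      actMat g (I.orderIsoOfFin rfl a) (J.orderIsoOfFin h b))
  else 0

/-- Action of `g` on a differential form `μ = ∑_I u_I dz_I`, given by its coefficient
function `u : Finset (Fin n) → F[V]`. -/
noncomputable def formAct (g : GLn F n) (u : Finset (Fin n) → MvPolynomial (Fin n) F) :
    Finset (Fin n) → MvPolynomial (Fin n) F :=
  fun J => ∑ I : Finset (Fin n), polyAct g (u I) * C (minorDet g I J)

/-- The sign arising when wedging `dz_I ∧ dz_J` into `dz_(I ∪ J)` for disjoint `I`, `J`. -/
def wsign (I J : Finset (Fin n)) : ℤ :=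
  (-1) ^ ((I ×ˢ J).filter fun p => p.2 < p.1).card

/-- Wedge product of differential forms in terms of coefficient functions. -/
noncomputable def wedgeF (u v : Finset (Fin n) → MvPolynomial (Fin n) F) :
    Finset (Fin n) → MvPolynomial (Fin n) F :=
  fun K => ∑ I ∈ K.powerset, wsign I (K \ I) • (u I * v (K \ I))

/-- The constant 0-form `1`. -/
noncomputable def unitForm : Finset (Fin n) → MvPolynomial (Fin n) F :=
  fun S => if S = ∅ then 1 else 0

/-- Iterated wedge product of a list of forms. -/
noncomputable def iterWedge (L : List (Finset (Fin n) → MvPolynomial (Fin n) F)) :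
    Finset (Fin n) → MvPolynomial (Fin n) F :=
  L.foldr wedgeF unitForm

/-- A 1-form, viewed as a differential form via its coefficient function. -/
noncomputable def oneToForm (w : Fin n → MvPolynomial (Fin n) F) :
    Finset (Fin n) → MvPolynomial (Fin n) F :=
  fun S => if h : S.card = 1 then w (S.min' (Finset.card_pos.mp (by omega))) else 0

/-- The fixed space of `g` in `V`. -/
noncomputable def fixedSpace (g : GLn F n) : Submodule F (Fin n → F) :=
  LinearMap.ker (g.toLinearMap - LinearMap.id)

/-- A reflection: an element of finite order whose fixed space is a hyperplane. -/
def IsReflection (g : GLn F n) : Prop :=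
  IsOfFinOrder g ∧ Module.finrank F (fixedSpace g) = n - 1

/-- A transvection: a (necessarily nondiagonalizable) reflection of determinant one. -/
def IsTransvection (g : GLn F n) : Prop :=
  IsReflection g ∧ LinearMap.det g.toLinearMap = 1 ∧ g ≠ 1

/-- The pointwise stabilizer `G_H` of a subspace `H` in `G`. -/
def pointStab (G : Subgroup (GLn F n)) (H : Submodule F (Fin n → F)) : Subgroup (GLn F n) where
  carrier := {g | g ∈ G ∧ ∀ v ∈ H, g v = v}
  one_mem' := ⟨G.one_mem, fun v _ => rfl⟩
  mul_mem' := fun {a b} ha hb => ⟨G.mul_mem ha.1 hb.1, fun v hv => by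
    show a (b v) = v
    rw [hb.2 v hv, ha.2 v hv]⟩
  inv_mem' := fun {a} ha => ⟨G.inv_mem ha.1, fun v hv => by
    show a.symm v = v
    conv_lhs => rw [← ha.2 v hv]
    exact a.symm_apply_apply v⟩

/-- `K_H`: the subgroup of `G_H` of elements of determinant one
(the transvections in `G_H` together with the identity). -/
noncomputable def KH (G : Subgroup (GLn F n)) (H : Submodule F (Fin n → F)) :
    Subgroup (GLn F n) :=
  pointStab G H ⊓ MonoidHom.ker LinearEquiv.det

/-- `e_H = |G_H : K_H|`. -/
noncomputable def eH (G : Subgroup (GLn F n)) (H : Submodule F (Fin n → F)) : ℕ :=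
  ((KH G H).subgroupOf (pointStab G H)).index

/-- The transvection root space of `G_H`: the span of the root vectors of the
transvections in `G_H` (the root vector of `t` spans the range of `t - 1`). -/
noncomputable def trvSpace (G : Subgroup (GLn F n)) (H : Submodule F (Fin n → F)) :
    Submodule F (Fin n → F) :=
  ⨆ g ∈ {g : GLn F n | g ∈ pointStab G H ∧ IsTransvection g},
    LinearMap.range (g.toLinearMap - LinearMap.id)

/-- `b_H`: the dimension of the transvection root space of `G_H`. -/
noncomputable def bH (G : Subgroup (GLn F n)) (H : Submodule F (Fin n → F)) : ℕ :=
  Module.finrank F (trvSpace G H)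

section AlternatingForms

open Set

/-- An alternating map on `Sⁿ` is determined by its values on increasing tuples of standard
basis vectors. -/
theorem alternatingMap_apply_eq_sum {S N : Type*} [CommRing S] [AddCommGroup N] [Module S N]
    {m k : ℕ} (φ : (Fin m → S) [⋀^Fin k]→ₗ[S] N) (v : Fin k → Fin m → S) :
    φ v = ∑ s : powersetCard (Fin m) k,
      (Matrix.of fun a b => v a (s.1.orderEmbOfFin s.2 b)).det •
        φ fun a => Pi.single (s.1.orderEmbOfFin s.2 a) 1 := by
  have h := congrArg (exteriorPower.alternatingMapLinearEquiv φ)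
    (((Pi.basisFun S (Fin m)).exteriorPower k).sum_repr (exteriorPower.ιMulti S k v))
  rw [exteriorPower.alternatingMapLinearEquiv_apply_ιMulti, map_sum] at h
  rw [← h]
  refine Finset.sum_congr rfl fun s _ => ?_
  rw [map_smul, exteriorPower.basis_repr_apply, exteriorPower.ιMultiDual_apply_ιMulti,
    exteriorPower.basis_apply, exteriorPower.ιMulti_family,
    exteriorPower.alternatingMapLinearEquiv_apply_ιMulti]
  congr 2
  ext a j
  simp [powersetCard.ofFinEmbEquiv_symm_apply]

/-- Expansion of an alternating map evaluated on linear combinations of given vectors. -/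
theorem alternatingMap_apply_linearCombination {S M N : Type*} [CommRing S] [AddCommGroup M]
    [Module S M] [AddCommGroup N] [Module S N] {m k : ℕ} (φ : M [⋀^Fin k]→ₗ[S] N)
    (x : Fin m → M) (c : Fin k → Fin m → S) :
    φ (fun a => ∑ i, c a i • x i) = ∑ s : powersetCard (Fin m) k,
      (Matrix.of fun a b => c a (s.1.orderEmbOfFin s.2 b)).det •
        φ fun a => x (s.1.orderEmbOfFin s.2 a) := by
  have h := alternatingMap_apply_eq_sum
    (φ.compLinearMap (Fintype.linearCombination S x)) c
  simpa [AlternatingMap.compLinearMap_apply, Fintype.linearCombination_apply,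
    Pi.single_apply] using h

/-- The alternating map on `Sᵐ` with coefficients `u`: it sends an increasing tuple of standard
basis vectors with index set `I` to `u I`. -/
noncomputable def evalForm (S : Type*) {R : Type*} [CommRing S] [CommRing R] [Algebra S R]
    {m : ℕ} (u : Finset (Fin m) → R) (k : ℕ) : (Fin m → S) [⋀^Fin k]→ₗ[S] R :=
  ∑ s : powersetCard (Fin m) k, (LinearMap.toSpanSingleton S R (u s.1)).compAlternatingMap
    (Matrix.detRowAlternating.compLinearMap (LinearMap.funLeft S S (s.1.orderEmbOfFin s.2)))

variable {S R : Type*} [CommRing S] [CommRing R] [Algebra S R] {m k : ℕ}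

theorem evalForm_apply (u : Finset (Fin m) → R) (v : Fin k → Fin m → S) :
    evalForm S u k v = ∑ s : powersetCard (Fin m) k,
      (Matrix.of fun a b => v a (s.1.orderEmbOfFin s.2 b)).det • u s.1 := by
  let ev : ((Fin m → S) [⋀^Fin k]→ₗ[S] R) →+ R :=
    { toFun := fun f => f v, map_zero' := rfl, map_add' := fun _ _ => rfl }
  exact map_sum ev _ _

theorem det_single_orderEmbOfFin [DecidableEq (powersetCard (Fin m) k)]
    (s t : powersetCard (Fin m) k) :
    (Matrix.of fun a b => (Pi.single (t.1.orderEmbOfFin t.2 a) (1 : S) : Fin m → S)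
      (s.1.orderEmbOfFin s.2 b)).det = if s = t then 1 else 0 := by
  split_ifs with h
  · subst h
    rw [← Matrix.det_one (n := Fin k)]
    congr 1
    ext a b
    simp [Pi.single_apply, Matrix.one_apply, eq_comm]
  · obtain ⟨i, his, hit⟩ := (powersetCard.exists_mem_notMem_iff_ne s t).mp h
    obtain ⟨j, hj⟩ := (powersetCard.mem_range_ofFinEmbEquiv_symm_iff_mem s i).mpr his
    rw [powersetCard.ofFinEmbEquiv_symm_apply] at hj
    refine Matrix.det_eq_zero_of_column_eq_zero j fun a => ?_
    rw [Matrix.of_apply, Pi.single_apply, if_neg]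
    rw [hj]
    rintro rfl
    exact hit (Finset.orderEmbOfFin_mem t.1 t.2 a)

theorem evalForm_single (u : Finset (Fin m) → R) (t : powersetCard (Fin m) k) :
    evalForm S u k (fun a => Pi.single (t.1.orderEmbOfFin t.2 a) 1) = u t.1 := by
  classical
  rw [evalForm_apply, Finset.sum_eq_single t]
  · simp [det_single_orderEmbOfFin]
  · intro s _ hs
    simp [det_single_orderEmbOfFin, hs]
  · simp

theorem eq_evalForm {u : Finset (Fin m) → R} (φ : (Fin m → S) [⋀^Fin k]→ₗ[S] R)
    (h : ∀ t : powersetCard (Fin m) k,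
      φ (fun a => Pi.single (t.1.orderEmbOfFin t.2 a) 1) = u t.1) : φ = evalForm S u k := by
  ext v
  rw [alternatingMap_apply_eq_sum φ v, evalForm_apply]
  simp [h]

end AlternatingForms

section Wedge

theorem oneToForm_singleton (w : Fin n → MvPolynomial (Fin n) F) (j : Fin n) :
    oneToForm w {j} = w j := by
  simp [oneToForm]

theorem oneToForm_of_card_ne {w : Fin n → MvPolynomial (Fin n) F} {S : Finset (Fin n)}
    (h : S.card ≠ 1) : oneToForm w S = 0 := by
  simp [oneToForm, h]

theorem wedgeF_oneToForm (w : Fin n → MvPolynomial (Fin n) F)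
    (v : Finset (Fin n) → MvPolynomial (Fin n) F) (K : Finset (Fin n)) :
    wedgeF (oneToForm w) v K =
      ∑ j ∈ K, wsign {j} (K \ {j}) • (w j * v (K \ {j})) := by
  simp_rw [wedgeF, ← oneToForm_singleton w]
  rw [← Finset.sum_image (s := K) (g := fun j => ({j} : Finset (Fin n)))
    (f := fun I => wsign I (K \ I) • (oneToForm w I * v (K \ I)))
    (Finset.singleton_injective.injOn)]
  refine (Finset.sum_subset ?_ ?_).symm
  · intro I hI
    obtain ⟨j, hj, rfl⟩ := Finset.mem_image.mp hI
    simpa using hj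
  · intro I hI hI'
    rw [oneToForm_of_card_ne, zero_mul, smul_zero]
    intro hc
    obtain ⟨j, rfl⟩ := Finset.card_eq_one.mp hc
    exact hI' (Finset.mem_image_of_mem _ (by simpa using hI))

theorem wsign_singleton_orderEmbOfFin {K : Finset (Fin n)} {k : ℕ} (h : K.card = k)
    (b : Fin k) :
    wsign {K.orderEmbOfFin h b} (K \ {K.orderEmbOfFin h b}) = (-1) ^ (b : ℕ) := by
  rw [wsign]
  congr 1
  rw [Finset.singleton_product, Finset.filter_map, Finset.card_map]
  have : (K \ {K.orderEmbOfFin h b}).filter (fun p => p < K.orderEmbOfFin h b) =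
      (Finset.Iio b).map (K.orderEmbOfFin h).toEmbedding := by
    ext x
    simp only [Finset.mem_filter, Finset.mem_sdiff, Finset.mem_singleton, Finset.mem_map,
      Finset.mem_Iio, RelEmbedding.coe_toEmbedding]
    constructor
    · rintro ⟨⟨hx, -⟩, hlt⟩
      rw [← Finset.mem_coe, ← Finset.range_orderEmbOfFin K h] at hx
      obtain ⟨c, rfl⟩ := hx
      exact ⟨c, by simpa using hlt, rfl⟩
    · rintro ⟨c, hc, rfl⟩
      have := (K.orderEmbOfFin h).strictMono hc
      exact ⟨⟨Finset.orderEmbOfFin_mem _ _ _, this.ne⟩, this⟩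
  have h2 := congrArg Finset.card this
  rw [Finset.card_map, Fin.card_Iio] at h2
  exact h2

theorem orderEmbOfFin_sdiff_singleton {K : Finset (Fin n)} {k : ℕ} (h : K.card = k + 1)
    (b : Fin (k + 1)) (h' : (K \ {K.orderEmbOfFin h b}).card = k) (c : Fin k) :
    (K \ {K.orderEmbOfFin h b}).orderEmbOfFin h' c = K.orderEmbOfFin h (b.succAbove c) := by
  refine (congrFun (Finset.orderEmbOfFin_unique h'
    (f := fun c => K.orderEmbOfFin h (b.succAbove c)) ?_ ?_) c).symm
  · intro c
    simp [Finset.orderEmbOfFin_mem, Fin.succAbove_ne]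
  · exact (K.orderEmbOfFin h).strictMono.comp (Fin.strictMono_succAbove b)

/-- The coefficients of a wedge of one-forms are the minors of its coefficient matrix. -/
theorem iterWedge_oneToForm (L : List (Fin n → MvPolynomial (Fin n) F)) (K : Finset (Fin n)) :
    iterWedge (L.map oneToForm) K =
      if h : K.card = L.length then
        (Matrix.of fun a b : Fin L.length => L[a] (K.orderEmbOfFin h b)).det else 0 := by
  induction L generalizing K with
  | nil =>
    simp only [iterWedge, List.map_nil, List.foldr_nil, unitForm, List.length_nil,
      Finset.card_eq_zero]
    split_ifs <;> simp
  | cons w L ih =>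
    have hcons : iterWedge ((w :: L).map oneToForm) =
      wedgeF (oneToForm w) (iterWedge (L.map oneToForm)) := rfl
    rw [hcons, wedgeF_oneToForm]
    have hcard : ∀ j ∈ K, (K \ {j}).card + 1 = K.card := fun j hj => by
      rw [Finset.sdiff_singleton_eq_erase, Finset.card_erase_add_one hj]
    split_ifs with h
    · rw [Matrix.det_succ_row_zero]
      have hsum : ∀ f : Fin n → MvPolynomial (Fin n) F,
          ∑ j ∈ K, f j = ∑ b, f (K.orderEmbOfFin h b) := fun f => by
        conv_lhs => rw [← Finset.map_orderEmbOfFin_univ K h]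
        rw [Finset.sum_map]
        rfl
      rw [hsum]
      refine Finset.sum_congr rfl fun b _ => ?_
      have hb : (K \ {K.orderEmbOfFin h b}).card = L.length := by
        exact Nat.succ.inj ((hcard _ (Finset.orderEmbOfFin_mem K h b)).trans h)
      rw [wsign_singleton_orderEmbOfFin, ih, dif_pos hb, zsmul_eq_mul, ← mul_assoc]
      congr 1
      · simp only [Int.cast_pow, Int.cast_neg, Int.cast_one]
        rfl
      · congr 1
        ext1 a c
        simp only [Matrix.of_apply, Matrix.submatrix_apply]
        rw [orderEmbOfFin_sdiff_singleton h b hb c]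
        rfl
    · refine Finset.sum_eq_zero fun j hj => ?_
      rw [ih, dif_neg, mul_zero, smul_zero]
      intro h'
      exact h (by rw [← hcard j hj, h', List.length_cons])

theorem iterWedge_sort_of_card_ne (ω : Fin n → Fin n → MvPolynomial (Fin n) F)
    {I K : Finset (Fin n)} (h : K.card ≠ I.card) :
    iterWedge ((I.sort (· ≤ ·)).map fun i => oneToForm (ω i)) K = 0 := by
  have := iterWedge_oneToForm ((I.sort (· ≤ ·)).map ω) K
  rw [List.map_map, dif_neg (by simpa using h)] at this
  exact this

theorem iterWedge_sort (ω : Fin n → Fin n → MvPolynomial (Fin n) F) {k : ℕ}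
    {I K : Finset (Fin n)} (hI : I.card = k) (hK : K.card = k) :
    iterWedge ((I.sort (· ≤ ·)).map fun i => oneToForm (ω i)) K =
      (Matrix.of fun a b => ω (I.orderEmbOfFin hI a) (K.orderEmbOfFin hK b)).det := by
  have hL : ((I.sort (· ≤ ·)).map ω).length = k := by simpa using hI
  have := iterWedge_oneToForm ((I.sort (· ≤ ·)).map ω) K
  rw [List.map_map, dif_pos (hK.trans hL.symm)] at this
  refine Eq.trans this ?_
  rw [← Matrix.det_submatrix_equiv_self (finCongr hL.symm)]
  congr 1
  ext1 a b
  simp only [Matrix.submatrix_apply, Matrix.of_apply, Finset.orderEmbOfFin_apply]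
  exact congrFun (List.getElem_map ω) _

end Wedge

section FormAction

open Set

theorem minorDet_of_card (g : GLn F n) {k : ℕ} {I J : Finset (Fin n)} (hI : I.card = k)
    (hJ : J.card = k) : minorDet g I J =
      (Matrix.of fun a b => actMat g (I.orderEmbOfFin hI a) (J.orderEmbOfFin hJ b)).det := by
  subst hI
  rw [minorDet, dif_pos hJ]
  rfl

theorem formAct_apply (g : GLn F n) (u : Finset (Fin n) → MvPolynomial (Fin n) F) {k : ℕ}
    (J : powersetCard (Fin n) k) : formAct g u J.1 = ∑ I : powersetCard (Fin n) k,
      polyAct g (u I.1) * C (Matrix.of fun a b =>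
        actMat g (I.1.orderEmbOfFin I.2 a) (J.1.orderEmbOfFin J.2 b)).det := by
  classical
  have hs : ∀ x : Finset (Fin n), x ∈ Finset.univ.filter (fun I : Finset (Fin n) => I.card = k) ↔
      x ∈ powersetCard (Fin n) k := fun x => by simp
  rw [formAct, ← Finset.sum_filter_add_sum_filter_not Finset.univ
    (fun I : Finset (Fin n) => I.card = k), Finset.sum_eq_zero (s := Finset.filter (fun I => ¬_) _),
    add_zero, Finset.sum_subtype _ hs]
  · exact Finset.sum_congr rfl fun I _ => by rw [minorDet_of_card g I.2 J.2]
  · intro I hI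
    have : ¬ J.1.card = I.card := fun h => (Finset.mem_filter.mp hI).2 (h.symm.trans J.2)
    rw [minorDet, dif_neg this, C_0, mul_zero]

theorem formAct_eq_evalForm (g : GLn F n) (u : Finset (Fin n) → MvPolynomial (Fin n) F) {k : ℕ}
    (J : powersetCard (Fin n) k) : formAct g u J.1 = polyAct g (evalForm F u k fun a =>
      g.symm (Pi.single (J.1.orderEmbOfFin J.2 a) 1)) := by
  rw [formAct_apply, evalForm_apply, map_sum]
  refine Finset.sum_congr rfl fun I _ => ?_
  rw [map_smul, smul_eq_C_mul, mul_comm, ← Matrix.det_transpose]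
  rfl

/-- Equivariance of the alternating map attached to an invariant form. -/
theorem evalForm_of_invariant {g : GLn F n} {u : Finset (Fin n) → MvPolynomial (Fin n) F}
    (hu : formAct g u = u) {k : ℕ} (v : Fin k → Fin n → F) :
    evalForm F u k (fun a => g (v a)) = polyAct g (evalForm F u k v) := by
  have h := eq_evalForm (S := F) (u := u) (k := k)
    (((polyAct g).toLinearMap.compAlternatingMap (evalForm F u k)).compLinearMap
      g.symm.toLinearMap) fun J => by
        conv_rhs => rw [← hu, formAct_eq_evalForm]
        rfl
  have h' := congrArg (fun φ => φ fun a => g (v a)) h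
  simpa using h'.symm

theorem formAct_iterWedge {g : GLn F n} {ω : Fin n → Fin n → MvPolynomial (Fin n) F}
    (hω : ∀ i, oneFormAct g (ω i) = ω i) {I J : Finset (Fin n)} (hJ : J.card = I.card) :
    formAct g (iterWedge ((I.sort (· ≤ ·)).map fun i => oneToForm (ω i))) J =
      iterWedge ((I.sort (· ≤ ·)).map fun i => oneToForm (ω i)) J := by
  rw [iterWedge_sort ω rfl hJ, formAct_apply g _ ⟨J, hJ⟩]
  have h := alternatingMap_apply_linearCombination
    (Matrix.detRowAlternating (n := Fin I.card) (R := MvPolynomial (Fin n) F))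
    (fun i a => polyAct g (ω (I.orderEmbOfFin rfl a) i))
    (fun b i => C (actMat g i (J.orderEmbOfFin hJ b)))
  rw [← Matrix.det_transpose]
  refine Eq.trans ?_ (h.symm.trans ?_)
  · refine Finset.sum_congr rfl fun S _ => ?_
    rw [iterWedge_sort ω rfl S.2, AlgHom.map_det, RingHom.map_det, smul_eq_mul, mul_comm,
      ← Matrix.det_transpose, ← Matrix.det_transpose (M := AlgHom.mapMatrix _ _)]
    rfl
  · refine congrArg Matrix.det ?_
    ext1 b a
    conv_rhs => rw [Matrix.transpose_apply, Matrix.of_apply, ← hω]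
    simp [oneFormAct, mul_comm]

theorem formAct_of_forall_card_ne {g : GLn F n} {u : Finset (Fin n) → MvPolynomial (Fin n) F}
    {k : ℕ} (hu : ∀ S, S.card ≠ k → u S = 0) {J : Finset (Fin n)} (hJ : J.card ≠ k) :
    formAct g u J = 0 := by
  refine Finset.sum_eq_zero fun I _ => ?_
  by_cases hI : I.card = k
  · rw [minorDet, dif_neg (fun h => hJ (h.trans hI)), C_0, mul_zero]
  · rw [hu I hI, map_zero, zero_mul]

end FormAction

section Cramer

open Set

variable {R : Type*} [CommRing R] {m k : ℕ}

theorem sum_minor_mul_evalForm_adjugate (M : Matrix (Fin m) (Fin m) R)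
    (u : Finset (Fin m) → R) (s : powersetCard (Fin m) k) :
    ∑ t : powersetCard (Fin m) k,
      (Matrix.of fun a b => M (t.1.orderEmbOfFin t.2 a) (s.1.orderEmbOfFin s.2 b)).det *
        evalForm R u k (fun a i => M.adjugate i (t.1.orderEmbOfFin t.2 a)) =
      M.det ^ k * u s.1 := by
  have h := alternatingMap_apply_linearCombination (evalForm R u k)
    (fun j i => M.adjugate i j) (fun a j => M j (s.1.orderEmbOfFin s.2 a))
  have h' : ∀ a : Fin k, ∑ j, M j (s.1.orderEmbOfFin s.2 a) • (fun i => M.adjugate i j) =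
      M.det • Pi.single (s.1.orderEmbOfFin s.2 a) 1 := fun a => by
    ext i
    have := congrFun (congrFun M.adjugate_mul i) (s.1.orderEmbOfFin s.2 a)
    rw [Matrix.mul_apply] at this
    simpa [Pi.single_apply, Matrix.one_apply, mul_comm] using this
  simp_rw [h'] at h
  rw [AlternatingMap.map_smul_univ, evalForm_single, Finset.prod_const, Finset.card_univ,
    Fintype.card_fin] at h
  rw [← smul_eq_mul, h]
  refine Finset.sum_congr rfl fun t _ => ?_
  rw [smul_eq_mul, ← Matrix.det_transpose]
  rfl

/-- The rows of minors of a matrix with regular determinant are linearly independent. -/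
theorem eq_zero_of_sum_mul_minor_eq_zero [IsDomain R] {M : Matrix (Fin m) (Fin m) R}
    (hM : M.det ≠ 0) {d : Finset (Fin m) → R}
    (h : ∀ s : powersetCard (Fin m) k, ∑ t : powersetCard (Fin m) k, d t.1 *
      (Matrix.of fun a b => M (t.1.orderEmbOfFin t.2 a) (s.1.orderEmbOfFin s.2 b)).det = 0)
    (t : powersetCard (Fin m) k) : d t.1 = 0 := by
  have hψ : ∀ v, (evalForm R d k).compLinearMap M.mulVecLin v = 0 := fun v => by
    rw [alternatingMap_apply_eq_sum]
    refine Finset.sum_eq_zero fun s _ => ?_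
    refine (congrArg _ ?_).trans (smul_zero _)
    rw [AlternatingMap.compLinearMap_apply, evalForm_apply, ← h s]
    refine Finset.sum_congr rfl fun t _ => ?_
    rw [smul_eq_mul, mul_comm, ← Matrix.det_transpose]
    congr 2
    ext a b
    simp
  have h1 := hψ fun a i => M.adjugate i (t.1.orderEmbOfFin t.2 a)
  have h2 : ∀ a : Fin k, M.mulVecLin (fun i => M.adjugate i (t.1.orderEmbOfFin t.2 a)) =
      M.det • Pi.single (t.1.orderEmbOfFin t.2 a) 1 := fun a => by
    ext i
    have := congrFun (congrFun M.mul_adjugate i) (t.1.orderEmbOfFin t.2 a)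
    rw [Matrix.mul_apply] at this
    simpa [Pi.single_apply, Matrix.one_apply, Matrix.mulVec, dotProduct] using this
  rw [AlternatingMap.compLinearMap_apply] at h1
  simp_rw [h2] at h1
  rw [AlternatingMap.map_smul_univ, evalForm_single, Finset.prod_const, smul_eq_mul] at h1
  exact (mul_eq_zero.mp h1).resolve_left (pow_ne_zero _ hM)

end Cramer

section LinearSubstitution

/-- Substitution of a linear endomorphism of `V` into polynomial functions on `V`. -/
noncomputable def linSub (φ : (Fin n → F) →ₗ[F] (Fin n → F)) :
    MvPolynomial (Fin n) F →ₐ[F] MvPolynomial (Fin n) F :=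
  aeval fun i => linToPoly (LinearMap.proj i ∘ₗ φ)

theorem polyAct_eq_linSub (g : GLn F n) : polyAct g = linSub g.symm.toLinearMap := rfl

theorem linToPoly_smul (c : F) (z : (Fin n → F) →ₗ[F] F) :
    linToPoly (c • z) = C c * linToPoly z := by
  simp [linToPoly, Finset.mul_sum, mul_assoc]

theorem linToPoly_sub (y z : (Fin n → F) →ₗ[F] F) :
    linToPoly (y - z) = linToPoly y - linToPoly z := by
  simp [linToPoly, sub_mul]

theorem linToPoly_zero : linToPoly (0 : (Fin n → F) →ₗ[F] F) = 0 := by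
  simp [linToPoly]

theorem linToPoly_proj (i : Fin n) :
    linToPoly (LinearMap.proj i : (Fin n → F) →ₗ[F] F) = X i := by
  simp [linToPoly, Pi.single_apply]

theorem eval_linToPoly (z : (Fin n → F) →ₗ[F] F) (v : Fin n → F) :
    eval v (linToPoly z) = z v := by
  conv_rhs => rw [← (Pi.basisFun F (Fin n)).sum_repr v, map_sum]
  simp [linToPoly, mul_comm]

theorem linToPoly_injective :
    Function.Injective (linToPoly : ((Fin n → F) →ₗ[F] F) → MvPolynomial (Fin n) F) := by
  intro y z h
  ext1 i
  ext
  simpa [eval_linToPoly] using congrArg (eval (Pi.single i (1 : F))) h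

theorem linToPoly_eq_zero {z : (Fin n → F) →ₗ[F] F} : linToPoly z = 0 ↔ z = 0 :=
  ⟨fun h => linToPoly_injective (h.trans linToPoly_zero.symm), fun h => h ▸ linToPoly_zero⟩

theorem linSub_X (φ : (Fin n → F) →ₗ[F] (Fin n → F)) (i : Fin n) :
    linSub φ (X i) = linToPoly (LinearMap.proj i ∘ₗ φ) :=
  aeval_X _ _

theorem linSub_linToPoly (φ : (Fin n → F) →ₗ[F] (Fin n → F)) (z : (Fin n → F) →ₗ[F] F) :
    linSub φ (linToPoly z) = linToPoly (z ∘ₗ φ) := by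
  have h : ∀ j, z (φ (Pi.single j 1)) = ∑ i, z (Pi.single i 1) * φ (Pi.single j 1) i :=
    fun j => by
      conv_lhs => rw [← (Pi.basisFun F (Fin n)).sum_repr (φ (Pi.single j 1)), map_sum]
      simp [mul_comm]
  rw [linToPoly, map_sum]
  simp_rw [map_mul, linSub_X, linToPoly, LinearMap.comp_apply, h, map_sum, Finset.sum_mul,
    Finset.mul_sum]
  rw [Finset.sum_comm]
  simp [linSub, mul_assoc]

theorem linSub_linSub (φ ψ : (Fin n → F) →ₗ[F] (Fin n → F)) (p : MvPolynomial (Fin n) F) :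
    linSub φ (linSub ψ p) = linSub (ψ ∘ₗ φ) p := by
  refine DFunLike.congr_fun
    (?_ : (linSub φ).comp (linSub ψ) = linSub (ψ ∘ₗ φ)) p
  refine algHom_ext fun i => ?_
  rw [AlgHom.comp_apply, linSub_X, linSub_linToPoly, linSub_X, LinearMap.comp_assoc]

theorem linSub_id (p : MvPolynomial (Fin n) F) : linSub LinearMap.id p = p := by
  have : linSub (LinearMap.id : (Fin n → F) →ₗ[F] (Fin n → F)) = AlgHom.id F _ :=
    algHom_ext fun i => by rw [linSub_X, LinearMap.comp_id, linToPoly_proj, AlgHom.id_apply]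
  rw [this, AlgHom.id_apply]

theorem polyAct_mul (g h : GLn F n) (p : MvPolynomial (Fin n) F) :
    polyAct (g * h) p = polyAct g (polyAct h p) := by
  simp_rw [polyAct_eq_linSub, linSub_linSub]
  rfl

theorem polyAct_one (p : MvPolynomial (Fin n) F) : polyAct (1 : GLn F n) p = p :=
  linSub_id p

theorem polyAct_linToPoly (g : GLn F n) (z : (Fin n → F) →ₗ[F] F) :
    polyAct g (linToPoly z) = linToPoly (z ∘ₗ g.symm.toLinearMap) :=
  linSub_linToPoly _ _

theorem polyAct_C (g : GLn F n) (c : F) : polyAct g (C c) = C c :=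
  (polyAct g).commutes c

/-- The projection of `V` onto the kernel of `l` along `w`, when `l w = 1`. -/
noncomputable def kerProj (l : (Fin n → F) →ₗ[F] F) (w : Fin n → F) :
    (Fin n → F) →ₗ[F] (Fin n → F) :=
  LinearMap.id - l.smulRight w

variable {l : (Fin n → F) →ₗ[F] F} {w : Fin n → F}

theorem kerProj_apply (v : Fin n → F) : kerProj l w v = v - l v • w := rfl

theorem apply_kerProj (hw : l w = 1) (v : Fin n → F) : l (kerProj l w v) = 0 := by
  simp [kerProj_apply, hw]

theorem kerProj_of_apply_eq_zero {v : Fin n → F} (hv : l v = 0) : kerProj l w v = v := by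
  simp [kerProj_apply, hv]

theorem linSub_kerProj_linToPoly_self (hw : l w = 1) :
    linSub (kerProj l w) (linToPoly l) = 0 := by
  rw [linSub_linToPoly, linToPoly_eq_zero]
  exact LinearMap.ext (apply_kerProj hw)

theorem linSub_kerProj_eq_zero (hw : l w = 1) {p : MvPolynomial (Fin n) F} :
    linSub (kerProj l w) p = 0 ↔ linToPoly l ∣ p := by
  constructor
  · intro h
    have hmk : (Ideal.Quotient.mkₐ F (Ideal.span {linToPoly l})).comp (linSub (kerProj l w)) =
        Ideal.Quotient.mkₐ F (Ideal.span {linToPoly l}) := by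
      refine algHom_ext fun i => ?_
      rw [AlgHom.comp_apply, linSub_X, Ideal.Quotient.mkₐ_eq_mk, Ideal.Quotient.eq,
        Ideal.mem_span_singleton, ← linToPoly_proj, ← linToPoly_sub]
      refine ⟨C (-w i), ?_⟩
      rw [mul_comm, ← linToPoly_smul]
      congr 1
      ext1 j
      ext
      simp [kerProj_apply, mul_comm]
    have := DFunLike.congr_fun hmk p
    rw [AlgHom.comp_apply, h, map_zero, Ideal.Quotient.mkₐ_eq_mk] at this
    exact Ideal.mem_span_singleton.mp (Ideal.Quotient.eq_zero_iff_mem.mp this.symm)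
  · rintro ⟨q, rfl⟩
    rw [map_mul, linSub_kerProj_linToPoly_self hw, zero_mul]

theorem exists_apply_eq_one (hl : l ≠ 0) : ∃ w, l w = 1 := by
  obtain ⟨v, hv⟩ := DFunLike.ne_iff.mp hl
  exact ⟨(l v)⁻¹ • v, by simpa using inv_mul_cancel₀ hv⟩

theorem linToPoly_prime (hl : l ≠ 0) : Prime (linToPoly l) := by
  obtain ⟨w, hw⟩ := exists_apply_eq_one hl
  refine ⟨fun h => hl (linToPoly_eq_zero.mp h), fun h => ?_, fun a b h => ?_⟩
  · have := h.map (linSub (kerProj l w))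
    rw [linSub_kerProj_linToPoly_self hw] at this
    exact not_isUnit_zero this
  · rw [← linSub_kerProj_eq_zero hw, map_mul, mul_eq_zero] at h
    exact h.imp (linSub_kerProj_eq_zero hw).mp (linSub_kerProj_eq_zero hw).mp

theorem linToPoly_dvd_linToPoly (hl : l ≠ 0) {z : (Fin n → F) →ₗ[F] F}
    (h : linToPoly l ∣ linToPoly z) : LinearMap.ker l ≤ LinearMap.ker z := by
  obtain ⟨w, hw⟩ := exists_apply_eq_one hl
  rw [← linSub_kerProj_eq_zero hw, linSub_linToPoly, linToPoly_eq_zero] at h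
  intro v hv
  have := DFunLike.congr_fun h v
  rwa [LinearMap.comp_apply, kerProj_of_apply_eq_zero hv] at this

theorem exists_smul_eq_of_ker_le {z : (Fin n → F) →ₗ[F] F}
    (h : LinearMap.ker l ≤ LinearMap.ker z) : ∃ c : F, z = c • l := by
  by_cases hl : l = 0
  · subst hl
    refine ⟨0, LinearMap.ext fun v => ?_⟩
    simpa using h (show v ∈ LinearMap.ker (0 : (Fin n → F) →ₗ[F] F) from rfl)
  · obtain ⟨w, hw⟩ := exists_apply_eq_one hl
    refine ⟨z w, LinearMap.ext fun v => ?_⟩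
    have : z (kerProj l w v) = 0 := h (apply_kerProj hw v)
    rw [kerProj_apply, map_sub, map_smul, sub_eq_zero] at this
    rw [this, LinearMap.smul_apply, smul_eq_mul, smul_eq_mul, mul_comm]

end LinearSubstitution

section PointwiseStabilizer

variable {G : Subgroup (GLn F n)} {l : (Fin n → F) →ₗ[F] F} {w : Fin n → F} {t : GLn F n}

theorem apply_of_mem_pointStab (hw : l w = 1) (ht : t ∈ pointStab G (LinearMap.ker l))
    (v : Fin n → F) : t v = v + l v • (t w - w) := by
  have h := ht.2 (kerProj l w v) (apply_kerProj hw v)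
  rw [kerProj_apply, map_sub, map_smul, sub_eq_iff_eq_add] at h
  rw [h, smul_sub]
  abel

theorem det_of_mem_pointStab (hw : l w = 1) (ht : t ∈ pointStab G (LinearMap.ker l)) :
    ((LinearEquiv.det t : Fˣ) : F) = l (t w) := by
  have h : (t : (Fin n → F) →ₗ[F] (Fin n → F)) = LinearMap.transvection l (t w - w) :=
    LinearMap.ext fun v => apply_of_mem_pointStab hw ht v
  rw [LinearEquiv.coe_det, h, LinearMap.transvection.det, map_sub, hw]
  ring

theorem form_apply_of_mem_pointStab (hw : l w = 1) (ht : t ∈ pointStab G (LinearMap.ker l))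
    (v : Fin n → F) : l (t v) = ((LinearEquiv.det t : Fˣ) : F) * l v := by
  rw [det_of_mem_pointStab hw ht, apply_of_mem_pointStab hw ht, map_add, map_smul, map_sub, hw,
    smul_eq_mul]
  ring

theorem polyAct_linToPoly_of_mem_pointStab (hw : l w = 1)
    (ht : t ∈ pointStab G (LinearMap.ker l)) :
    polyAct t (linToPoly l) = C (((LinearEquiv.det t)⁻¹ : Fˣ) : F) * linToPoly l := by
  rw [polyAct_linToPoly, ← linToPoly_smul]
  congr 1
  refine LinearMap.ext fun v => ?_
  have h := form_apply_of_mem_pointStab hw (inv_mem ht) v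
  rwa [map_inv] at h

theorem linSub_kerProj_polyAct (hw : l w = 1) (ht : t ∈ pointStab G (LinearMap.ker l))
    (p : MvPolynomial (Fin n) F) :
    linSub (kerProj l w) (polyAct t p) = linSub (kerProj l w) p := by
  rw [polyAct_eq_linSub, linSub_linSub]
  congr 2
  exact LinearMap.ext fun v => (inv_mem ht).2 _ (apply_kerProj hw v)

/-- The determinant character of the pointwise stabilizer. -/
noncomputable def detHom (G : Subgroup (GLn F n)) (H : Submodule F (Fin n → F)) :
    pointStab G H →* Fˣ :=
  LinearEquiv.det.comp (pointStab G H).subtype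

theorem eH_eq_card_range (H : Submodule F (Fin n → F)) :
    eH G H = Nat.card (detHom G H).range := by
  rw [← Subgroup.index_ker, eH]
  congr 1
  ext x
  simp [KH, Subgroup.mem_subgroupOf, detHom, MonoidHom.mem_ker]

theorem det_pow_eH {H : Submodule F (Fin n → F)} (ht : t ∈ pointStab G H) :
    LinearEquiv.det t ^ eH G H = 1 := by
  rw [eH_eq_card_range]
  exact congrArg Subtype.val
    (pow_card_eq_one' (x := (⟨_, ⟨⟨t, ht⟩, rfl⟩⟩ : (detHom G H).range)))

theorem finite_pointStab [Finite G] (H : Submodule F (Fin n → F)) : Finite (pointStab G H) :=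
  Finite.Set.subset (G : Set (GLn F n)) fun _ h => h.1

theorem finite_range_detHom [Finite G] (H : Submodule F (Fin n → F)) :
    Finite (detHom G H).range :=
  have := finite_pointStab (G := G) H
  Finite.of_surjective _ (detHom G H).rangeRestrict_surjective

theorem exists_orderOf_det_eq_eH [Finite G] (H : Submodule F (Fin n → F)) :
    ∃ s ∈ pointStab G H, orderOf (LinearEquiv.det s : Fˣ) = eH G H := by
  have := finite_range_detHom (G := G) H
  obtain ⟨⟨_, ⟨s, rfl⟩⟩, hs⟩ := IsCyclic.exists_ofOrder_eq_natCard (α := (detHom G H).range)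
  refine ⟨s.1, s.2, ?_⟩
  rw [eH_eq_card_range, ← hs, ← Subgroup.orderOf_coe]
  rfl

theorem eH_pos [Finite G] (H : Submodule F (Fin n → F)) : 0 < eH G H := by
  have := finite_range_detHom (G := G) H
  rw [eH_eq_card_range]
  exact Nat.card_pos

theorem eq_det_inv_pow_of_polyAct_eq (hw : l w = 1) (ht : t ∈ pointStab G (LinearMap.ker l))
    {a : ℕ} {p : MvPolynomial (Fin n) F} (hp : ¬ linToPoly l ∣ p) {κ : F}
    (h : polyAct t (linToPoly l ^ a * p) = C κ * (linToPoly l ^ a * p)) :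
    κ = (((LinearEquiv.det t)⁻¹ ^ a : Fˣ) : F) := by
  have hl : l ≠ 0 := by rintro rfl; simp at hw
  have h1 : C (((LinearEquiv.det t)⁻¹ ^ a : Fˣ) : F) * polyAct t p = C κ * p := by
    refine mul_left_cancel₀ (pow_ne_zero a (linToPoly_prime hl).ne_zero) ?_
    rw [map_mul, map_pow, polyAct_linToPoly_of_mem_pointStab hw ht, mul_pow, ← C_pow] at h
    rw [Units.val_pow_eq_pow_val]
    linear_combination h
  have h2 := congrArg (linSub (kerProj l w)) h1
  rw [map_mul, map_mul, linSub_kerProj_polyAct hw ht] at h2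
  have hC : ∀ c : F, linSub (kerProj l w) (C c) = C c := fun c => (linSub _).commutes c
  rw [hC, hC] at h2
  exact (C_injective _ _ (mul_right_cancel₀
    (mt (linSub_kerProj_eq_zero hw).mp hp) h2)).symm

theorem exists_eq_linToPoly_pow_mul (hl : l ≠ 0) {f : MvPolynomial (Fin n) F} (hf : f ≠ 0) :
    ∃ a p, f = linToPoly l ^ a * p ∧ ¬ linToPoly l ∣ p := by
  obtain ⟨p, h1, h2⟩ :=
    (FiniteMultiplicity.of_prime_left (linToPoly_prime hl) hf).exists_eq_pow_mul_and_not_dvd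
  exact ⟨_, p, h1, h2⟩

theorem linToPoly_pow_dvd_of_polyAct_eq (hw : l w = 1)
    (ht : t ∈ pointStab G (LinearMap.ker l)) {j : ℕ} {f : MvPolynomial (Fin n) F}
    (hf : polyAct t f = C (((LinearEquiv.det t) ^ j : Fˣ) : F) * f)
    (h : j ≠ 0 ∨ linToPoly l ∣ f) :
    linToPoly l ^ (orderOf (LinearEquiv.det t : Fˣ) - j) ∣ f := by
  by_cases hf0 : f = 0
  · exact hf0 ▸ dvd_zero _
  have hl : l ≠ 0 := by rintro rfl; simp at hw
  obtain ⟨a, p, rfl, hp⟩ := exists_eq_linToPoly_pow_mul hl hf0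
  have h1 := Units.ext (eq_det_inv_pow_of_polyAct_eq hw ht hp hf)
  rw [inv_pow, eq_inv_iff_mul_eq_one, ← pow_add] at h1
  have h2 : j + a ≠ 0 := by
    rintro h0
    obtain ⟨rfl, rfl⟩ : j = 0 ∧ a = 0 := by omega
    rw [pow_zero, one_mul] at h
    tauto
  have h3 := Nat.le_of_dvd (by omega) (orderOf_dvd_of_pow_eq_one h1)
  exact Dvd.dvd.mul_right (pow_dvd_pow _ (by omega)) _

theorem trvSpace_eq_ker (hw : l w = 1) (hb : bH G (LinearMap.ker l) = n - 1) :
    trvSpace G (LinearMap.ker l) = LinearMap.ker l := by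
  refine Submodule.eq_of_le_of_finrank_eq (iSup₂_le ?_) (hb.trans ?_)
  · rintro g ⟨hg, hg'⟩ _ ⟨v, rfl⟩
    have h1 : ((LinearEquiv.det g : Fˣ) : F) = 1 := (LinearEquiv.coe_det g).trans hg'.2.1
    have h2 := form_apply_of_mem_pointStab hw hg v
    rw [h1, one_mul] at h2
    show l (g v - v) = 0
    rw [map_sub, h2, sub_self]
  · have h1 := LinearMap.finrank_range_add_finrank_ker l
    have hs : Function.Surjective l := fun c => ⟨c • w, by simp [hw]⟩
    rw [LinearMap.range_eq_top.mpr hs, finrank_top, Module.finrank_self,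
      Module.finrank_fin_fun] at h1
    omega

variable {u : Finset (Fin n) → MvPolynomial (Fin n) F} {k : ℕ}

theorem linToPoly_dvd_evalForm (hw : l w = 1) (hb : bH G (LinearMap.ker l) = n - 1)
    (hu : ∀ g ∈ G, formAct g u = u) (v : Fin k → Fin n → F) (hv : ∀ i, l (v i) = 0)
    (hk : k ≠ 0) : linToPoly l ∣ evalForm F u k v := by
  let i : Fin k := ⟨0, Nat.pos_of_ne_zero hk⟩
  let K := LinearMap.ker ((linSub (kerProj l w)).toLinearMap ∘ₗ
    (evalForm F u k).toMultilinearMap.toLinearMap v i)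
  have hK : trvSpace G (LinearMap.ker l) ≤ K := by
    refine iSup₂_le ?_
    rintro g ⟨hg, hg'⟩ _ ⟨x, rfl⟩
    show ((linSub (kerProj l w)).toLinearMap ∘ₗ
      (evalForm F u k).toMultilinearMap.toLinearMap v i) (g x - x) = 0
    rw [map_sub, sub_eq_zero]
    show linSub (kerProj l w) (evalForm F u k (Function.update v i (g x))) =
      linSub (kerProj l w) (evalForm F u k (Function.update v i x))
    have h1 : Function.update v i (g x) = fun a => g (Function.update v i x a) := by
      funext a
      by_cases h : a = i
      · subst h; simp
      · simp [h, hg.2 _ (hv a)]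
    rw [h1, evalForm_of_invariant (hu g hg.1), linSub_kerProj_polyAct hw hg]
  have h2 : v i ∈ K := hK (by rw [trvSpace_eq_ker hw hb]; exact hv i)
  have h3 : linSub (kerProj l w) (evalForm F u k (Function.update v i (v i))) = 0 := h2
  rwa [Function.update_eq_self, linSub_kerProj_eq_zero hw] at h3

theorem linToPoly_pow_eH_dvd_evalForm [Finite G] (hw : l w = 1)
    (hb : bH G (LinearMap.ker l) = n - 1)
    (hu : ∀ g ∈ G, formAct g u = u) (v : Fin k → Fin n → F) (hv : ∀ i, l (v i) = 0)
    (hk : k ≠ 0) : linToPoly l ^ eH G (LinearMap.ker l) ∣ evalForm F u k v := by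
  obtain ⟨s, hs, ho⟩ := exists_orderOf_det_eq_eH (G := G) (LinearMap.ker l)
  rw [← ho]
  refine linToPoly_pow_dvd_of_polyAct_eq (j := 0) hw hs ?_
    (Or.inr (linToPoly_dvd_evalForm hw hb hu v hv hk))
  rw [← evalForm_of_invariant (hu s hs.1), pow_zero, Units.val_one, C_1, one_mul]
  simp only [hs.2 _ (hv _)]

/-- A vector off the hyperplane along which invariant forms keep all but one of the factors
of the hyperplane's linear form. -/
theorem exists_linToPoly_pow_eH_sub_one_dvd_evalForm [Finite G] (hw : l w = 1) :
    ∃ x, l x ≠ 0 ∧ ∀ (u : Finset (Fin n) → MvPolynomial (Fin n) F) (k : ℕ),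
      (∀ g ∈ G, formAct g u = u) → ∀ (v : Fin k → Fin n → F) (i : Fin k), v i = x →
        (∀ j, j ≠ i → l (v j) = 0) →
          linToPoly l ^ (eH G (LinearMap.ker l) - 1) ∣ evalForm F u k v := by
  obtain ⟨s, hs, ho⟩ := exists_orderOf_det_eq_eH (G := G) (LinearMap.ker l)
  have hd := det_of_mem_pointStab hw hs
  by_cases h1 : l (s w) = 1
  · refine ⟨w, by simp [hw], fun u k _ v i _ _ => ?_⟩
    have : (LinearEquiv.det s : Fˣ) = 1 := Units.ext (hd.trans h1)
    rw [← ho, this, orderOf_one, Nat.sub_self, pow_zero]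
    exact one_dvd _
  · refine ⟨s w - w, by rwa [map_sub, hw, sub_ne_zero], fun u k hu v i hi hv => ?_⟩
    rw [← ho]
    refine linToPoly_pow_dvd_of_polyAct_eq (j := 1) hw hs ?_ (Or.inl one_ne_zero)
    have h2 : (fun a => s (v a)) =
        Function.update v i (((LinearEquiv.det s : Fˣ) : F) • v i) := by
      funext a
      by_cases h : a = i
      · subst h
        rw [Function.update_self, hi, apply_of_mem_pointStab hw hs (s w - w), hd, map_sub, hw,
          sub_smul, one_smul, add_sub_cancel]
      · rw [Function.update_of_ne h, hs.2 _ (hv a h)]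
    rw [← evalForm_of_invariant (hu s hs.1), h2, AlternatingMap.map_update_smul,
      Function.update_eq_self, pow_one, smul_eq_C_mul]

end PointwiseStabilizer

theorem evalForm_map_C (u : Finset (Fin n) → MvPolynomial (Fin n) F) {k : ℕ}
    (v : Fin k → Fin n → F) :
    evalForm (MvPolynomial (Fin n) F) u k (fun a i => C (v a i)) = evalForm F u k v := by
  rw [evalForm_apply, evalForm_apply]
  refine Finset.sum_congr rfl fun s _ => ?_
  rw [smul_eq_C_mul, RingHom.map_det, smul_eq_mul]
  rfl

section LocalDivisibility

variable {G : Subgroup (GLn F n)} {l : (Fin n → F) →ₗ[F] F} {w : Fin n → F}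

theorem exists_basis_of_apply_ne_zero {x : Fin n → F} (hx : l x ≠ 0) :
    ∃ (b : Module.Basis (Fin n) F (Fin n → F)) (i₀ : Fin n),
      b i₀ = x ∧ ∀ j, j ≠ i₀ → l (b j) = 0 := by
  obtain _ | m := n
  · exact absurd (by rw [Subsingleton.elim x 0, map_zero]) hx
  have hs : Function.Surjective l := fun c => ⟨(c * (l x)⁻¹) • x, by simp [hx]⟩
  have hr : Module.finrank F (LinearMap.ker l) = m := by
    have h1 := LinearMap.finrank_range_add_finrank_ker l
    rw [LinearMap.range_eq_top.mpr hs, finrank_top, Module.finrank_self,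
      Module.finrank_fin_fun] at h1
    omega
  refine ⟨Module.Basis.mkFinCons x (Module.finBasisOfFinrankEq F _ hr) ?_ ?_, 0, ?_, ?_⟩
  · intro c y hy h
    have := congrArg l h
    rw [map_add, map_smul, LinearMap.mem_ker.mp hy, add_zero, map_zero, smul_eq_mul] at this
    exact (mul_eq_zero.mp this).resolve_right hx
  · refine fun z => ⟨-(l z * (l x)⁻¹), ?_⟩
    simp [hx]
  · simp
  · intro j hj
    obtain ⟨i, rfl⟩ := Fin.exists_succ_eq.mpr hj
    simp

theorem evalForm_iterWedge_singleton (ω : Fin n → Fin n → MvPolynomial (Fin n) F) (i : Fin n)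
    (v : Fin 1 → Fin n → F) :
    evalForm F (iterWedge ((({i} : Finset (Fin n)).sort (· ≤ ·)).map fun i => oneToForm (ω i))) 1
      v = ∑ j, ω i j * C (v 0 j) := by
  let f : (Fin n → F) →ₗ[F] MvPolynomial (Fin n) F :=
    ∑ j, (LinearMap.proj j : (Fin n → F) →ₗ[F] F).smulRight (ω i j)
  have hf : ∀ x, f x = ∑ j, ω i j * C (x j) := fun x => by
    simp [f, smul_eq_C_mul, mul_comm]
  rw [← eq_evalForm (AlternatingMap.ofSubsingleton F (Fin n → F) _ (0 : Fin 1) f)]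
  · exact hf _
  · intro t
    rw [iterWedge_sort ω (Finset.card_singleton i) t.2, Matrix.det_unique]
    refine (hf _).trans ?_
    simp [Pi.single_apply, apply_ite C]

theorem dvd_sum_mul_C {ω : Fin n → Fin n → MvPolynomial (Fin n) F}
    (hω : ∀ i, ∀ g ∈ G, oneFormAct g (ω i) = ω i) (i : Fin n) {v : Fin n → F} {m : ℕ}
    (h : ∀ u, (∀ g ∈ G, formAct g u = u) → linToPoly l ^ m ∣ evalForm F u 1 fun _ => v) :
    linToPoly l ^ m ∣ ∑ j, ω i j * C (v j) := by
  rw [← evalForm_iterWedge_singleton ω i fun _ => v]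
  refine h _ fun g hg => funext fun J => ?_
  by_cases hJ : J.card = ({i} : Finset (Fin n)).card
  · exact formAct_iterWedge (fun i => hω i g hg) hJ
  · rw [iterWedge_sort_of_card_ne ω hJ]
    exact formAct_of_forall_card_ne (fun S hS => iterWedge_sort_of_card_ne ω hS) hJ

open Set in
theorem prod_pow_dvd_evalForm_adjugate {k : ℕ} (u : Finset (Fin n) → MvPolynomial (Fin n) F)
    (M : Matrix (Fin n) (Fin n) (MvPolynomial (Fin n) F))
    (b : Module.Basis (Fin n) F (Fin n → F)) (d : Fin n → MvPolynomial (Fin n) F)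
    (hd : ∀ i c, d c ∣ ∑ j, M i j * C (b c j)) (D : MvPolynomial (Fin n) F)
    (hu : ∀ s : powersetCard (Fin n) k, ∏ a, d (s.1.orderEmbOfFin s.2 a) ∣
      evalForm F u k (fun a => b (s.1.orderEmbOfFin s.2 a)) * D) (J : Fin k → Fin n) :
    (∏ c, d c) ^ k ∣
      evalForm (MvPolynomial (Fin n) F) u k (fun a i => M.adjugate i (J a)) * D := by
  choose N hN using hd
  let P : Matrix (Fin n) (Fin n) F := Matrix.of fun j c => b c j
  have hP : IsUnit (C P.det : MvPolynomial (Fin n) F) := by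
    have h1 : P * b.toMatrix (Pi.basisFun F (Fin n)) = 1 :=
      Module.Basis.toMatrix_mul_toMatrix_flip (Pi.basisFun F (Fin n)) b
    have h2 := congrArg Matrix.det h1
    rw [Matrix.det_mul, Matrix.det_one] at h2
    exact (IsUnit.of_mul_eq_one _ h2).map C
  let PR := P.map (C : F →+* MvPolynomial (Fin n) F)
  have hPR : PR.det = C P.det := (RingHom.map_det _ _).symm
  have hM : M * PR = Matrix.of N * Matrix.diagonal d := by
    ext1 i c
    rw [Matrix.mul_diagonal, Matrix.mul_apply, mul_comm]
    exact hN i c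
  let e : Fin n → MvPolynomial (Fin n) F := fun c => ∏ c' ∈ Finset.univ.erase c, d c'
  have hadj : ∀ i j, C P.det * M.adjugate i j =
      ∑ c, e c * (Matrix.of N).adjugate c j * C (b c i) := fun i j => by
    have h1 := congrArg (fun Q => PR * Matrix.adjugate Q) hM
    simp only [Matrix.adjugate_mul_distrib, Matrix.adjugate_diagonal] at h1
    rw [← Matrix.mul_assoc, Matrix.mul_adjugate, hPR, smul_mul_assoc, one_mul] at h1
    have h2 := congrFun (congrFun h1 i) j
    rw [Matrix.smul_apply, smul_eq_mul, Matrix.mul_apply] at h2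
    rw [h2]
    refine Finset.sum_congr rfl fun c _ => ?_
    rw [Matrix.diagonal_mul, mul_comm]
    rfl
  have hsum : C P.det ^ k *
      evalForm (MvPolynomial (Fin n) F) u k (fun a i => M.adjugate i (J a)) =
      ∑ s : powersetCard (Fin n) k, (∏ a, e (s.1.orderEmbOfFin s.2 a)) *
        (Matrix.of fun a c => (Matrix.of N).adjugate (s.1.orderEmbOfFin s.2 c) (J a)).det *
        evalForm F u k (fun a => b (s.1.orderEmbOfFin s.2 a)) := by
    have h1 := (evalForm (MvPolynomial (Fin n) F) u k).toMultilinearMap.map_smul_univ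
      (fun _ => C P.det) (fun a i => M.adjugate i (J a))
    have h2 := alternatingMap_apply_linearCombination
      (evalForm (MvPolynomial (Fin n) F) u k) (fun c i => C (b c i))
      (fun a c => e c * (Matrix.of N).adjugate c (J a))
    rw [Finset.prod_const, Finset.card_univ, Fintype.card_fin, smul_eq_mul] at h1
    refine h1.symm.trans (Eq.trans ?_ (h2.trans (Finset.sum_congr rfl fun s _ => ?_)))
    · show evalForm _ u k _ = _
      congr 1
      funext a i
      rw [Pi.smul_apply, smul_eq_mul, hadj, Finset.sum_apply]
      rfl
    · rw [evalForm_map_C, smul_eq_mul, ← Matrix.det_mul_row]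
      rfl
  rw [← (hP.pow k).dvd_mul_left, ← mul_assoc, hsum, Finset.sum_mul]
  refine Finset.dvd_sum fun s _ => ?_
  have hT : (∏ c, d c) ^ k =
      (∏ a, e (s.1.orderEmbOfFin s.2 a)) * ∏ a, d (s.1.orderEmbOfFin s.2 a) := by
    rw [← Finset.prod_mul_distrib, Finset.prod_congr rfl fun a _ =>
      Finset.prod_erase_mul Finset.univ d (Finset.mem_univ _), Finset.prod_const,
      Finset.card_univ, Fintype.card_fin]
  rw [hT, mul_assoc, mul_assoc]
  exact mul_dvd_mul_left _ (Dvd.dvd.mul_left (hu s) _)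

open Set in
theorem linToPoly_pow_dvd_evalForm_adjugate [Finite G] (hw : l w = 1)
    (hb : bH G (LinearMap.ker l) = n - 1) {ω : Fin n → Fin n → MvPolynomial (Fin n) F}
    (hω : ∀ i, ∀ g ∈ G, oneFormAct g (ω i) = ω i)
    {u : Finset (Fin n) → MvPolynomial (Fin n) F} (hu : ∀ g ∈ G, formAct g u = u)
    {k : ℕ} (J : Fin k → Fin n) :
    (linToPoly l ^ (eH G (LinearMap.ker l) * (n - 1) + eH G (LinearMap.ker l) - 1)) ^ k ∣
      evalForm (MvPolynomial (Fin n) F) u k (fun a i => (Matrix.of ω).adjugate i (J a)) *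
        (linToPoly l ^ eH G (LinearMap.ker l)) ^ (k - 1) := by
  obtain ⟨x, hx, hxu⟩ := exists_linToPoly_pow_eH_sub_one_dvd_evalForm (G := G) hw
  obtain ⟨b, i₀, rfl, hb₀⟩ := exists_basis_of_apply_ne_zero hx
  set e := eH G (LinearMap.ker l) with he
  have he0 : 0 < e := eH_pos _
  let m : Fin n → ℕ := fun c => if c = i₀ then e - 1 else e
  have hm : ∑ c, m c = e * (n - 1) + e - 1 := by
    rw [← Finset.add_sum_erase _ _ (Finset.mem_univ i₀), Finset.sum_congr rfl fun c hc =>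
      if_neg (Finset.ne_of_mem_erase hc), Finset.sum_const, Finset.card_erase_of_mem
      (Finset.mem_univ _), Finset.card_univ, Fintype.card_fin, smul_eq_mul, mul_comm (n - 1)]
    simp only [m, if_true]
    omega
  rw [← hm, ← Finset.prod_pow_eq_pow_sum]
  refine prod_pow_dvd_evalForm_adjugate u _ b (fun c => linToPoly l ^ m c) ?_ _ ?_ J
  · intro i c
    refine dvd_sum_mul_C hω i fun u hu => ?_
    by_cases hc : c = i₀
    · subst hc
      simp only [m, if_true]
      exact hxu u 1 hu _ 0 rfl fun j hj => absurd (Subsingleton.elim j 0) hj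
    · simp only [m, if_neg hc]
      exact linToPoly_pow_eH_dvd_evalForm hw hb hu _ (fun _ => hb₀ c hc) one_ne_zero
  · intro s
    rw [Finset.prod_pow_eq_pow_sum]
    obtain rfl | k := k
    · simp
    rw [Nat.add_sub_cancel, ← pow_mul]
    by_cases hs : ∃ a, s.1.orderEmbOfFin s.2 a = i₀
    · obtain ⟨a, ha⟩ := hs
      have ha' : ∀ a', a' ≠ a → s.1.orderEmbOfFin s.2 a' ≠ i₀ := fun a' h h' =>
        h ((s.1.orderEmbOfFin s.2).injective (h'.trans ha.symm))
      have h1 : ∑ a, m (s.1.orderEmbOfFin s.2 a) = e - 1 + e * k := by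
        rw [← Finset.add_sum_erase _ _ (Finset.mem_univ a), Finset.sum_congr rfl fun c hc =>
          if_neg (ha' c (Finset.ne_of_mem_erase hc)), Finset.sum_const,
          Finset.card_erase_of_mem (Finset.mem_univ _), Finset.card_univ, Fintype.card_fin,
          smul_eq_mul, Nat.add_sub_cancel, mul_comm k]
        simp only [m, ha, if_true]
      rw [h1, pow_add]
      exact mul_dvd_mul_right (hxu u _ hu _ a (congrArg b ha) fun j hj => hb₀ _ (ha' j hj)) _
    · push Not at hs
      have h1 : ∑ a, m (s.1.orderEmbOfFin s.2 a) = e + e * k := by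
        rw [Finset.sum_congr rfl fun c _ => if_neg (hs c), Finset.sum_const,
          Finset.card_univ, Fintype.card_fin, smul_eq_mul]
        ring
      rw [h1, pow_add]
      exact mul_dvd_mul_right (linToPoly_pow_eH_dvd_evalForm hw hb hu _
        (fun a => hb₀ _ (hs a)) k.succ_ne_zero) _

end LocalDivisibility

section GlobalDivisibility

variable {G : Subgroup (GLn F n)} {A : Finset (Submodule F (Fin n → F))}
  {ℓ : Submodule F (Fin n → F) → ((Fin n → F) →ₗ[F] F)}

theorem isRelPrime_linToPoly (hℓ : ∀ H ∈ A, ℓ H ≠ 0 ∧ LinearMap.ker (ℓ H) = H)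
    {H K : Submodule F (Fin n → F)} (hH : H ∈ A) (hK : K ∈ A) (hne : H ≠ K) :
    IsRelPrime (linToPoly (ℓ H)) (linToPoly (ℓ K)) := by
  rw [(linToPoly_prime (hℓ H hH).1).irreducible.isRelPrime_iff_not_dvd]
  intro h
  have h1 := linToPoly_dvd_linToPoly (hℓ H hH).1 h
  obtain ⟨c, hc⟩ := exists_smul_eq_of_ker_le h1
  have hc0 : c ≠ 0 := by
    rintro rfl
    exact (hℓ K hK).1 (by rw [hc, zero_smul])
  refine hne ?_
  rw [← (hℓ H hH).2, ← (hℓ K hK).2, hc, LinearMap.ker_smul _ _ hc0]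

theorem det_pow_dvd_evalForm_adjugate [Finite G]
    (hb : ∀ H ∈ A, bH G H = n - 1)
    (hℓ : ∀ H ∈ A, ℓ H ≠ 0 ∧ LinearMap.ker (ℓ H) = H)
    {ω : Fin n → Fin n → MvPolynomial (Fin n) F}
    (hω : ∀ i, ∀ g ∈ G, oneFormAct g (ω i) = ω i) {c : F} (hc : c ≠ 0)
    (hdet : (Matrix.of ω).det =
      C c * ∏ H ∈ A, linToPoly (ℓ H) ^ (eH G H * bH G H + eH G H - 1))
    {u : Finset (Fin n) → MvPolynomial (Fin n) F} (hu : ∀ g ∈ G, formAct g u = u)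
    {k : ℕ} (J : Fin k → Fin n) :
    (Matrix.of ω).det ^ k ∣
      evalForm (MvPolynomial (Fin n) F) u k (fun a i => (Matrix.of ω).adjugate i (J a)) *
        (∏ H ∈ A, linToPoly (ℓ H) ^ eH G H) ^ (k - 1) := by
  have hcu : IsUnit (C c : MvPolynomial (Fin n) F) := (Ne.isUnit hc).map C
  rw [hdet, mul_pow, (hcu.pow k).mul_left_dvd, ← Finset.prod_pow]
  refine Finset.prod_dvd_of_isRelPrime ?_ fun H hH => ?_
  · intro H hH K hK hne
    exact ((isRelPrime_linToPoly hℓ hH hK hne).pow).pow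
  · obtain ⟨w, hw⟩ := exists_apply_eq_one (hℓ H hH).1
    have h1 := linToPoly_pow_dvd_evalForm_adjugate (G := G) hw
      (by rw [(hℓ H hH).2]; exact hb H hH) hω hu J
    rw [(hℓ H hH).2] at h1
    rw [hb H hH]
    refine h1.trans (mul_dvd_mul_left _ (pow_dvd_pow_of_dvd ?_ _))
    exact Finset.dvd_prod_of_mem (fun H => linToPoly (ℓ H) ^ eH G H) hH

end GlobalDivisibility

section ProductOfForms

variable {G : Subgroup (GLn F n)}

theorem fixedSpace_conj (g t : GLn F n) :
    fixedSpace (g * t * g⁻¹) = (fixedSpace t).map g.toLinearMap := by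
  ext v
  rw [Submodule.mem_map_equiv]
  show g (t (g.symm v)) - v = 0 ↔ t (g.symm v) - g.symm v = 0
  rw [sub_eq_zero, sub_eq_zero, LinearEquiv.eq_symm_apply]

theorem isReflection_conj (g : GLn F n) {t : GLn F n} (ht : IsReflection t) :
    IsReflection (g * t * g⁻¹) := by
  refine ⟨?_, ?_⟩
  · exact (MulAut.conj g).toMonoidHom.isOfFinOrder ht.1
  · rw [fixedSpace_conj]
    exact (LinearEquiv.finrank_map_eq g (fixedSpace t)).trans ht.2

theorem conj_mem_pointStab {g t : GLn F n} (hg : g ∈ G) {H : Submodule F (Fin n → F)}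
    (ht : t ∈ pointStab G H) : g * t * g⁻¹ ∈ pointStab G (H.map g.toLinearMap) := by
  refine ⟨mul_mem (mul_mem hg ht.1) (inv_mem hg), ?_⟩
  rintro _ ⟨v, hv, rfl⟩
  show g (t (g.symm (g v))) = g v
  rw [g.symm_apply_apply, ht.2 v hv]

theorem map_map_inv (g : GLn F n) (H : Submodule F (Fin n → F)) :
    (H.map g.toLinearMap).map (g⁻¹ : GLn F n).toLinearMap = H := by
  rw [← Submodule.map_comp]
  refine Eq.trans ?_ (Submodule.map_id H)
  congr 1
  exact LinearMap.ext fun v => g.symm_apply_apply v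

theorem range_detHom_le_range_detHom_map {g : GLn F n} (hg : g ∈ G)
    (H : Submodule F (Fin n → F)) :
    (detHom G H).range ≤ (detHom G (H.map g.toLinearMap)).range := by
  rintro _ ⟨⟨t, ht⟩, rfl⟩
  refine ⟨⟨_, conj_mem_pointStab hg ht⟩, ?_⟩
  show LinearEquiv.det (g * t * g⁻¹) = LinearEquiv.det t
  rw [map_mul, map_mul, map_inv, mul_comm, inv_mul_cancel_left]

theorem eH_map {g : GLn F n} (hg : g ∈ G) (H : Submodule F (Fin n → F)) :
    eH G (H.map g.toLinearMap) = eH G H := by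
  have h : (detHom G (H.map g.toLinearMap)).range = (detHom G H).range := by
    refine le_antisymm ?_ (range_detHom_le_range_detHom_map hg H)
    conv_rhs => rw [← map_map_inv g H]
    exact range_detHom_le_range_detHom_map (inv_mem hg) _
  rw [eH_eq_card_range, eH_eq_card_range, h]

variable {A : Finset (Submodule F (Fin n → F))}
  {ℓ : Submodule F (Fin n → F) → ((Fin n → F) →ₗ[F] F)}

theorem map_mem_arrangement (hA : ∀ H, H ∈ A ↔ ∃ g ∈ G, IsReflection g ∧ fixedSpace g = H)
    {g : GLn F n} (hg : g ∈ G) {H : Submodule F (Fin n → F)} (hH : H ∈ A) :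
    H.map g.toLinearMap ∈ A := by
  obtain ⟨t, ht, hr, rfl⟩ := (hA H).mp hH
  exact (hA _).mpr ⟨_, mul_mem (mul_mem hg ht) (inv_mem hg), isReflection_conj g hr,
    fixedSpace_conj g t⟩

theorem exists_polyAct_linToPoly_eq
    (hA : ∀ H, H ∈ A ↔ ∃ g ∈ G, IsReflection g ∧ fixedSpace g = H)
    (hℓ : ∀ H ∈ A, ℓ H ≠ 0 ∧ LinearMap.ker (ℓ H) = H)
    {g : GLn F n} (hg : g ∈ G) {H : Submodule F (Fin n → F)} (hH : H ∈ A) :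
    ∃ c : F, polyAct g (linToPoly (ℓ H)) = C c * linToPoly (ℓ (H.map g.toLinearMap)) := by
  have h : LinearMap.ker (ℓ (H.map g.toLinearMap)) ≤
      LinearMap.ker (ℓ H ∘ₗ g.symm.toLinearMap) := by
    rw [(hℓ _ (map_mem_arrangement hA hg hH)).2]
    rintro _ ⟨v, hv, rfl⟩
    rw [← (hℓ H hH).2] at hv
    show ℓ H (g.symm (g v)) = 0
    rw [g.symm_apply_apply]
    exact hv
  obtain ⟨c, hc⟩ := exists_smul_eq_of_ker_le h
  exact ⟨c, by rw [polyAct_linToPoly, hc, linToPoly_smul]⟩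

theorem exists_polyAct_prod_eq
    (hA : ∀ H, H ∈ A ↔ ∃ g ∈ G, IsReflection g ∧ fixedSpace g = H)
    (hℓ : ∀ H ∈ A, ℓ H ≠ 0 ∧ LinearMap.ker (ℓ H) = H) {g : GLn F n} (hg : g ∈ G) :
    ∃ c : F, polyAct g (∏ H ∈ A, linToPoly (ℓ H) ^ eH G H) =
      C c * ∏ H ∈ A, linToPoly (ℓ H) ^ eH G H := by
  have h : ∀ H : A, ∃ c : F, polyAct g (linToPoly (ℓ H) ^ eH G H) = C c *
      linToPoly (ℓ (H.1.map g.toLinearMap)) ^ eH G (H.1.map g.toLinearMap) := fun H => by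
    obtain ⟨c, hc⟩ := exists_polyAct_linToPoly_eq hA hℓ hg H.2
    exact ⟨c ^ eH G H, by rw [map_pow, hc, mul_pow, C_pow, eH_map hg]⟩
  choose c hc using h
  refine ⟨∏ H : A, c H, ?_⟩
  rw [map_prod, ← Finset.prod_coe_sort, Finset.prod_congr rfl fun H _ => hc H,
    Finset.prod_mul_distrib, map_prod]
  congr 1
  refine (Finset.prod_coe_sort A fun H => linToPoly (ℓ (H.map g.toLinearMap)) ^
    eH G (H.map g.toLinearMap)).trans ?_
  refine Finset.prod_nbij' (fun H => H.map g.toLinearMap)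
    (fun H => H.map (g⁻¹ : GLn F n).toLinearMap) (fun H hH => map_mem_arrangement hA hg hH)
    (fun H hH => map_mem_arrangement hA (inv_mem hg) hH) (fun H _ => map_map_inv g H)
    (fun H _ => ?_) fun _ _ => rfl
  conv_rhs => rw [← map_map_inv g⁻¹ H, inv_inv]

theorem prod_linToPoly_pow_ne_zero (hℓ : ∀ H ∈ A, ℓ H ≠ 0 ∧ LinearMap.ker (ℓ H) = H)
    (m : Submodule F (Fin n → F) → ℕ) : ∏ H ∈ A, linToPoly (ℓ H) ^ m H ≠ 0 :=
  Finset.prod_ne_zero_iff.mpr fun H hH => pow_ne_zero _ (linToPoly_prime (hℓ H hH).1).ne_zero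

/-- The character by which `G` scales a nonzero polynomial that it preserves up to scalars. -/
theorem exists_character {d : MvPolynomial (Fin n) F} (hd : d ≠ 0)
    (h : ∀ g ∈ G, ∃ c : F, polyAct g d = C c * d) :
    ∃ χ : G →* Fˣ, ∀ g : G, polyAct g.1 d = C (χ g : F) * d := by
  choose c hc using fun g : G => h g.1 g.2
  let χ : G →* F :=
    { toFun := c
      map_one' := by
        have h1 : polyAct (1 : GLn F n) d = C (c 1) * d := hc 1
        rw [polyAct_one] at h1
        refine C_injective (Fin n) F (mul_right_cancel₀ hd ?_)
        rw [← h1, C_1, one_mul]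
      map_mul' := fun x y => by
        have h1 : polyAct (x.1 * y.1) d = C (c (x * y)) * d := hc (x * y)
        refine C_injective (Fin n) F (mul_right_cancel₀ hd ?_)
        rw [← h1, polyAct_mul, hc, map_mul, hc, polyAct_C, C_mul]
        ring }
  exact ⟨χ.toHomUnits, hc⟩

theorem character_eq_one_of_mem_pointStab (hℓ : ∀ H ∈ A, ℓ H ≠ 0 ∧ LinearMap.ker (ℓ H) = H)
    {χ : G →* Fˣ} (hχ : ∀ g : G, polyAct g.1 (∏ H ∈ A, linToPoly (ℓ H) ^ eH G H) =
      C (χ g : F) * ∏ H ∈ A, linToPoly (ℓ H) ^ eH G H)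
    {H : Submodule F (Fin n → F)} (hH : H ∈ A) (t : G) (ht : t.1 ∈ pointStab G H) :
    χ t = 1 := by
  classical
  obtain ⟨w, hw⟩ := exists_apply_eq_one (hℓ H hH).1
  have hp : ¬ linToPoly (ℓ H) ∣ ∏ K ∈ A.erase H, linToPoly (ℓ K) ^ eH G K := by
    have hprime := linToPoly_prime (hℓ H hH).1
    rw [hprime.dvd_finsetProd_iff]
    rintro ⟨K, hK, h⟩
    rw [Finset.mem_erase] at hK
    exact hprime.not_isUnit (isRelPrime_linToPoly hℓ hH hK.2 hK.1.symm dvd_rfl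
      (hprime.dvd_of_dvd_pow h))
  have h1 := hχ t
  rw [← Finset.mul_prod_erase A _ hH] at h1
  have ht' : t.1 ∈ pointStab G (LinearMap.ker (ℓ H)) := by rwa [(hℓ H hH).2]
  have h2 := Units.ext (eq_det_inv_pow_of_polyAct_eq hw ht' hp h1)
  rw [h2, inv_pow, det_pow_eH ht, inv_one]

end ProductOfForms

theorem eq_zero_of_sum_mul_monoidHom_eq_zero {ι M L : Type*} [Fintype ι] [MulOneClass M]
    [CommRing L] [IsDomain L] (θ : ι → M →* L) (c : ι → L)
    (h : ∀ y, ∑ i, c i * θ i y = 0) {i₀ : ι} (hi : ∀ i, θ i = θ i₀ → i = i₀) : c i₀ = 0 := by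
  classical
  have h2 := linearIndependent_iff'.mp (linearIndependent_monoidHom M L)
    (Finset.univ.image θ) (fun φ => ∑ i ∈ Finset.univ.filter (fun i => θ i = φ), c i) ?_
    (θ i₀) (Finset.mem_image_of_mem _ (Finset.mem_univ _))
  · rw [← h2, Finset.sum_eq_single i₀]
    · intro i hi' hne
      exact absurd (hi i (Finset.mem_filter.mp hi').2) hne
    · simp
  · funext y
    rw [Finset.sum_apply, Pi.zero_apply, ← h y,
      ← Finset.sum_fiberwise_of_maps_to (g := θ) (t := Finset.univ.image θ)
        fun i _ => Finset.mem_image_of_mem _ (Finset.mem_univ _)]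
    refine Finset.sum_congr rfl fun φ _ => ?_
    rw [Pi.smul_apply, smul_eq_mul, Finset.sum_mul]
    refine Finset.sum_congr rfl fun i hi' => ?_
    rw [(Finset.mem_filter.mp hi').2]

theorem eq_of_one_add_linToPoly_pow_eq {y z : (Fin n → F) →ₗ[F] F} {k : ℕ} (hk : k ≠ 0)
    (h : (1 + linToPoly y) ^ k = (1 + linToPoly z) ^ k) : y = z := by
  have h1 : (1 + linToPoly y) ∣ (1 + linToPoly z) :=
    (IsIntegrallyClosed.pow_dvd_pow_iff hk).mp h.dvd
  have h2 : (1 + linToPoly z) ∣ (1 + linToPoly y) :=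
    (IsIntegrallyClosed.pow_dvd_pow_iff hk).mp h.symm.dvd
  obtain ⟨r, hr⟩ := associated_of_dvd_dvd h1 h2
  obtain ⟨κ, -, hκ⟩ := MvPolynomial.isUnit_iff_eq_C_of_isReduced.mp r.isUnit
  rw [hκ] at hr
  have h3 := congrArg (eval (0 : Fin n → F)) hr
  simp only [map_mul, map_add, map_one, eval_linToPoly, map_zero, add_zero, eval_C,
    one_mul] at h3
  rw [h3, C_1, mul_one] at hr
  exact linToPoly_injective (add_left_cancel hr)

section Orbits

variable {G : Subgroup (GLn F n)} {l : (Fin n → F) →ₗ[F] F} {w : Fin n → F}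

/-- The product of the translates of a polynomial under a finite group. -/
noncomputable def groupNorm (S : Subgroup (GLn F n)) [Fintype S] :
    MvPolynomial (Fin n) F →* MvPolynomial (Fin n) F :=
  ∏ t : S, (polyAct t.1 : MvPolynomial (Fin n) F →* MvPolynomial (Fin n) F)

theorem groupNorm_apply (S : Subgroup (GLn F n)) [Fintype S] (y : MvPolynomial (Fin n) F) :
    groupNorm S y = ∏ t : S, polyAct t.1 y := by
  rw [groupNorm, MonoidHom.finsetProd_apply]
  rfl

theorem polyAct_groupNorm {S : Subgroup (GLn F n)} [Fintype S] {t : GLn F n} (ht : t ∈ S)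
    (y : MvPolynomial (Fin n) F) : polyAct t (groupNorm S y) = groupNorm S y := by
  simp_rw [groupNorm_apply, map_prod, ← polyAct_mul]
  exact Fintype.prod_equiv (Equiv.mulLeft (⟨t, ht⟩ : S)) _ _ fun _ => rfl

theorem linSub_kerProj_groupNorm (hw : l w = 1) [Fintype (pointStab G (LinearMap.ker l))]
    (y : MvPolynomial (Fin n) F) :
    linSub (kerProj l w) (groupNorm (pointStab G (LinearMap.ker l)) y) =
      linSub (kerProj l w) y ^ Fintype.card (pointStab G (LinearMap.ker l)) := by
  rw [groupNorm_apply, map_prod, Finset.prod_congr rfl fun t _ =>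
    linSub_kerProj_polyAct hw t.2 y, Finset.prod_const, Finset.card_univ]

theorem linSub_kerProj_polyAct_groupNorm (hw : l w = 1)
    [Fintype (pointStab G (LinearMap.ker l))] {g : GLn F n}
    (hg : ∀ v, l v = 0 → l (g.symm v) = 0) (y : MvPolynomial (Fin n) F) :
    linSub (kerProj l w) (polyAct g (groupNorm (pointStab G (LinearMap.ker l)) y)) =
      linSub (kerProj l w) (polyAct g y) ^ Fintype.card (pointStab G (LinearMap.ker l)) := by
  rw [groupNorm_apply, map_prod, map_prod, ← Finset.card_univ, ← Finset.prod_const]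
  refine Finset.prod_congr rfl fun t _ => ?_
  simp_rw [polyAct_eq_linSub, linSub_linSub]
  congr 2
  exact LinearMap.ext fun v => (inv_mem t.2).2 _ (hg _ (apply_kerProj hw v))

/-- Restricted to a hyperplane, the translates of the norm over its pointwise stabilizer
determine the coset of the translating element. -/
theorem mem_pointStab_of_linSub_kerProj_groupNorm_eq (hw : l w = 1)
    [Fintype (pointStab G (LinearMap.ker l))] {g : GLn F n} (hgG : g ∈ G)
    (h : ∀ y, linSub (kerProj l w)
      (polyAct g (groupNorm (pointStab G (LinearMap.ker l)) y)) =
        linSub (kerProj l w) (groupNorm (pointStab G (LinearMap.ker l)) y)) :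
    g ∈ pointStab G (LinearMap.ker l) := by
  have hl : l ≠ 0 := by rintro rfl; simp at hw
  have hk : Fintype.card (pointStab G (LinearMap.ker l)) ≠ 0 := Fintype.card_ne_zero
  have hg : ∀ v, l v = 0 → l (g.symm v) = 0 := by
    have h1 := h (linToPoly l)
    rw [linSub_kerProj_groupNorm hw, linSub_kerProj_linToPoly_self hw, zero_pow hk,
      groupNorm_apply, map_prod, map_prod, Finset.prod_eq_zero_iff] at h1
    obtain ⟨t, -, h2⟩ := h1
    rw [polyAct_linToPoly_of_mem_pointStab hw t.2, map_mul, map_mul, polyAct_C, mul_eq_zero]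
      at h2
    have h3 : linSub (kerProj l w) (polyAct g (linToPoly l)) = 0 := by
      refine h2.resolve_left fun h4 => ?_
      rw [← algebraMap_eq, AlgHom.commutes, algebraMap_eq, C_eq_zero] at h4
      exact Units.ne_zero _ h4
    rw [linSub_kerProj_eq_zero hw, polyAct_linToPoly] at h3
    exact linToPoly_dvd_linToPoly hl h3
  have h1 : ∀ i, (LinearMap.proj i : (Fin n → F) →ₗ[F] F) ∘ₗ g.symm.toLinearMap ∘ₗ
      kerProj l w = LinearMap.proj i ∘ₗ kerProj l w := fun i => by
    refine eq_of_one_add_linToPoly_pow_eq hk ?_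
    have h2 := h (1 + linToPoly (LinearMap.proj i))
    rwa [linSub_kerProj_groupNorm hw, linSub_kerProj_polyAct_groupNorm hw hg, map_add, map_add,
      map_one, map_one, polyAct_linToPoly, linSub_linToPoly, map_add, map_one,
      linSub_linToPoly] at h2
  refine ⟨hgG, fun v hv => ?_⟩
  have h2 : g.symm v = v := funext fun i => by
    have h3 := DFunLike.congr_fun (h1 i) v
    simpa [kerProj_of_apply_eq_zero (LinearMap.mem_ker.mp hv)] using h3
  conv_lhs => rw [← h2]
  exact g.apply_symm_apply v

theorem exists_semiinvariant_not_dvd [Finite G] (hw : l w = 1) (χ : G →* Fˣ)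
    (hχ : ∀ t : G, t.1 ∈ pointStab G (LinearMap.ker l) → χ t = 1) :
    ∃ f, (∀ g : G, polyAct g.1 f = C (χ g : F) * f) ∧ ¬ linToPoly l ∣ f := by
  classical
  have := finite_pointStab (G := G) (LinearMap.ker l)
  have := Fintype.ofFinite (pointStab G (LinearMap.ker l))
  let I : Subgroup G := (pointStab G (LinearMap.ker l)).subgroupOf G
  have := Fintype.ofFinite (G ⧸ I)
  let N := groupNorm (pointStab G (LinearMap.ker l))
  let ψ : MvPolynomial (Fin n) F → G → MvPolynomial (Fin n) F := fun y g =>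
    C (((χ g)⁻¹ : Fˣ) : F) * polyAct g.1 (N y)
  have hψ : ∀ (y) (g t : G), t ∈ I → ψ y (g * t) = ψ y g := fun y g t ht => by
    show C _ * polyAct (g.1 * t.1) (N y) = _
    rw [map_mul, hχ t ht, mul_one, polyAct_mul, polyAct_groupNorm ht]
  have hout : ∀ (y) (g : G), ψ y (g : G ⧸ I).out = ψ y g := fun y g => by
    obtain ⟨t, ht⟩ := QuotientGroup.mk_out_eq_mul I g
    rw [ht, hψ y g t t.2]
  have hact : ∀ (y) (h g : G), polyAct h.1 (ψ y g) = C (χ h : F) * ψ y (h * g) := by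
    intro y h g
    show polyAct h.1 (C _ * polyAct g.1 (N y)) = C _ * (C _ * polyAct (h.1 * g.1) (N y))
    rw [map_mul, polyAct_C, ← polyAct_mul, ← mul_assoc, ← C_mul, ← Units.val_mul, map_mul χ,
      mul_inv, mul_inv_cancel_left]
  have hinv : ∀ (y) (h : G), polyAct h.1 (∑ q : G ⧸ I, ψ y q.out) =
      C (χ h : F) * ∑ q : G ⧸ I, ψ y q.out := fun y h => by
    rw [map_sum, Finset.mul_sum, Finset.sum_congr rfl fun q _ => hact y h q.out]
    refine Fintype.sum_equiv (MulAction.toPerm h) _ _ fun q => ?_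
    have h1 : ((h * q.out : G) : G ⧸ I) = h • q := by
      conv_rhs => rw [← QuotientGroup.out_eq' q]
      rfl
    rw [← hout y (h * q.out), h1]
    rfl
  by_contra! hcon
  let θ : G ⧸ I → MvPolynomial (Fin n) F →* MvPolynomial (Fin n) F := fun q =>
    (linSub (kerProj l w) : MvPolynomial (Fin n) F →* MvPolynomial (Fin n) F).comp
      ((polyAct (q.out : G).1 : MvPolynomial (Fin n) F →* MvPolynomial (Fin n) F).comp N)
  have h0 := eq_zero_of_sum_mul_monoidHom_eq_zero θ
    (fun q => C (((χ q.out)⁻¹ : Fˣ) : F)) (i₀ := ((1 : G) : G ⧸ I)) (fun y => ?_) fun q hq => ?_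
  · rw [C_eq_zero] at h0
    exact Units.ne_zero _ h0
  · have h1 := (linSub_kerProj_eq_zero hw).mpr (hcon _ (hinv y))
    rw [map_sum] at h1
    rw [← h1]
    refine Finset.sum_congr rfl fun q _ => ?_
    show _ = linSub _ (C _ * polyAct _ (N y))
    rw [map_mul, ← algebraMap_eq, AlgHom.commutes]
    rfl
  · rw [← QuotientGroup.out_eq' q]
    refine (QuotientGroup.eq.mpr ?_).symm
    rw [inv_one, one_mul]
    refine mem_pointStab_of_linSub_kerProj_groupNorm_eq hw q.out.2 fun y => ?_
    obtain ⟨t, ht⟩ := QuotientGroup.mk_out_eq_mul I 1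
    have h1 : linSub (kerProj l w) (polyAct q.out.1 (N y)) =
      linSub (kerProj l w) (polyAct ((1 : G) : G ⧸ I).out.1 (N y)) := DFunLike.congr_fun hq y
    rw [ht, one_mul, polyAct_groupNorm (S := pointStab G (LinearMap.ker l)) (t := t.1.1) t.2] at h1
    exact h1

end Orbits

section SemiInvariants

variable {G : Subgroup (GLn F n)}

theorem uniqueFactorizationMonoid_invSub
    (hpoly : ∃ f : Fin n → MvPolynomial (Fin n) F, (∀ i, f i ∈ invSub G) ∧
      AlgebraicIndependent F f ∧ Algebra.adjoin F (Set.range f) = invSub G) :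
    UniqueFactorizationMonoid (invSub G) := by
  obtain ⟨f, -, hf, h⟩ := hpoly
  rw [← h]
  exact hf.aevalEquiv.toMulEquiv.uniqueFactorizationMonoid inferInstance

/-- The semi-invariants of a given character, when the invariant ring is factorial, are the
multiples of any one of them that is minimal for divisibility. -/
theorem exists_semiinvariant_dvd [Finite G] [UniqueFactorizationMonoid (invSub G)]
    (χ : G →* Fˣ) {d : MvPolynomial (Fin n) F} (hd : d ≠ 0)
    (hχ : ∀ g : G, polyAct g.1 d = C (χ g : F) * d) :
    ∃ f, (∀ g : G, polyAct g.1 f = C (χ g : F) * f) ∧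
      ∀ f', (∀ g : G, polyAct g.1 f' = C (χ g : F) * f') → f ∣ f' := by
  obtain ⟨f, ⟨hf0, hf⟩, hmin⟩ :=
    (wellFounded_dvdNotUnit (α := MvPolynomial (Fin n) F)).has_min
    {f | f ≠ 0 ∧ ∀ g : G, polyAct g.1 f = C (χ g : F) * f} ⟨d, hd, hχ⟩
  refine ⟨f, hf, fun f' hf' => ?_⟩
  set m := Nat.card G with hm
  have hm0 : m ≠ 0 := Nat.card_pos.ne'
  have hχm : ∀ g, (χ g : F) ^ m = 1 := fun g => by
    rw [← Units.val_pow_eq_pow_val, ← map_pow, hm, pow_card_eq_one', map_one, Units.val_one]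
  have hprod : ∀ p, (∀ g : G, polyAct g.1 p = C (χ g : F) * p) →
      p * f ^ (m - 1) ∈ invSub G := fun p hp g hg => by
    rw [map_mul, map_pow, hp ⟨g, hg⟩, hf ⟨g, hg⟩, mul_pow, mul_mul_mul_comm, ← pow_succ',
      Nat.sub_add_cancel (Nat.one_le_iff_ne_zero.mpr hm0), ← C_pow, hχm, C_1, one_mul]
  have hpow : ∀ p, (∀ g : G, polyAct g.1 p = C (χ g : F) * p) →
      p ^ m ∈ invSub G := fun p hp g hg => by
    rw [map_pow, hp ⟨g, hg⟩, mul_pow, ← C_pow, hχm, C_1, one_mul]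
  have ha0 : (⟨_, hprod f hf⟩ : invSub G) ≠ 0 := fun h =>
    mul_ne_zero hf0 (pow_ne_zero _ hf0) (congrArg Subtype.val h)
  obtain ⟨x, y, z, hxy, hx, hy⟩ := UniqueFactorizationMonoid.exists_reduced_factors
    (⟨_, hprod f hf⟩ : invSub G) ha0 ⟨_, hprod f' hf'⟩
  have hz0 : (z : MvPolynomial (Fin n) F) ≠ 0 := fun h => ha0 (by
    rw [← hx, Subtype.ext h (a2 := (0 : invSub G)), zero_mul])
  have hx' : (z : MvPolynomial (Fin n) F) * x = f * f ^ (m - 1) := congrArg Subtype.val hx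
  have hy' : (z : MvPolynomial (Fin n) F) * y = f' * f ^ (m - 1) := congrArg Subtype.val hy
  have hcross : f * (y : MvPolynomial (Fin n) F) = f' * x := by
    refine mul_left_cancel₀ (mul_ne_zero hz0 (pow_ne_zero (m - 1) hf0)) ?_
    linear_combination (f * f ^ (m - 1)) * hy' - (f' * f ^ (m - 1)) * hx'
  have hxf : (x : MvPolynomial (Fin n) F) ∣ f := by
    have h1 : x ^ m ∣ (⟨_, hpow f hf⟩ : invSub G) * y ^ m := by
      refine ⟨⟨_, hpow f' hf'⟩, Subtype.ext ?_⟩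
      show f ^ m * (y : MvPolynomial (Fin n) F) ^ m = (x : MvPolynomial (Fin n) F) ^ m * f' ^ m
      rw [← mul_pow, hcross, mul_pow, mul_comm]
    have h2 := map_dvd (invSub G).val (hxy.pow.dvd_of_dvd_mul_right h1)
    exact (IsIntegrallyClosed.pow_dvd_pow_iff hm0).mp h2
  obtain ⟨w, hw⟩ := hxf
  have hx0 : (x : MvPolynomial (Fin n) F) ≠ 0 := fun h => hf0 (by rw [hw, h, zero_mul])
  have hw0 : w ≠ 0 := fun h => hf0 (by rw [hw, h, mul_zero])
  have hwχ : ∀ g : G, polyAct g.1 w = C (χ g : F) * w := fun g => by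
    refine mul_left_cancel₀ hx0 ?_
    have h1 := hf g
    rw [hw, map_mul, x.2 g.1 g.2] at h1
    rw [h1]
    ring
  have hxu : IsUnit (x : MvPolynomial (Fin n) F) := by
    by_contra hx
    exact hmin w ⟨hw0, hwχ⟩ ⟨hw0, x, hx, by rw [hw, mul_comm]⟩
  refine ⟨hxu.unit⁻¹ * y, mul_left_cancel₀ hx0 ?_⟩
  rw [mul_comm, ← hcross]
  have : (x : MvPolynomial (Fin n) F) * ((hxu.unit⁻¹ : (MvPolynomial (Fin n) F)ˣ) :
    MvPolynomial (Fin n) F) = 1 := hxu.mul_val_inv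
  linear_combination (-f * y) * this

variable {A : Finset (Submodule F (Fin n → F))}
  {ℓ : Submodule F (Fin n → F) → ((Fin n → F) →ₗ[F] F)}

theorem polyAct_prod_linToPoly_pow_eH [Finite G]
    (hpoly : ∃ f : Fin n → MvPolynomial (Fin n) F, (∀ i, f i ∈ invSub G) ∧
      AlgebraicIndependent F f ∧ Algebra.adjoin F (Set.range f) = invSub G)
    (hA : ∀ H, H ∈ A ↔ ∃ g ∈ G, IsReflection g ∧ fixedSpace g = H)
    (hℓ : ∀ H ∈ A, ℓ H ≠ 0 ∧ LinearMap.ker (ℓ H) = H) {g : GLn F n} (hg : g ∈ G) :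
    polyAct g (∏ H ∈ A, linToPoly (ℓ H) ^ eH G H) = ∏ H ∈ A, linToPoly (ℓ H) ^ eH G H := by
  have := uniqueFactorizationMonoid_invSub hpoly
  have hd := prod_linToPoly_pow_ne_zero hℓ (eH G)
  obtain ⟨χ, hχ⟩ := exists_character hd fun g hg => exists_polyAct_prod_eq hA hℓ hg
  obtain ⟨f, hf, hdvd⟩ := exists_semiinvariant_dvd χ hd hχ
  have hf0 : f ≠ 0 := fun h => hd (zero_dvd_iff.mp (h ▸ hdvd _ hχ))
  have hfu : IsUnit f := by
    by_contra hfu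
    obtain ⟨p, hp, hpf⟩ := WfDvdMonoid.exists_irreducible_factor hfu hf0
    obtain ⟨H, hH, hpH⟩ := (hp.prime.dvd_finsetProd_iff _).mp (hpf.trans (hdvd _ hχ))
    have hHp : linToPoly (ℓ H) ∣ p := hp.dvd_symm (linToPoly_prime (hℓ H hH).1).irreducible
      (hp.prime.dvd_of_dvd_pow hpH)
    obtain ⟨w, hw⟩ := exists_apply_eq_one (hℓ H hH).1
    obtain ⟨q, hq, hHq⟩ := exists_semiinvariant_not_dvd (G := G) hw χ fun t ht =>
      character_eq_one_of_mem_pointStab hℓ hχ hH t (by rwa [(hℓ H hH).2] at ht)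
    exact hHq (hHp.trans (hpf.trans (hdvd q hq)))
  obtain ⟨r, -, rfl⟩ := MvPolynomial.isUnit_iff_eq_C_of_isReduced.mp hfu
  have h1 := hf ⟨g, hg⟩
  rw [polyAct_C] at h1
  have h2 : C ((χ ⟨g, hg⟩ : Fˣ) : F) = (1 : MvPolynomial (Fin n) F) :=
    mul_right_cancel₀ hf0 (by rw [one_mul, ← h1])
  exact (hχ ⟨g, hg⟩).trans (by rw [h2, one_mul])

end SemiInvariants

theorem formAct_mul (g : GLn F n) (p : MvPolynomial (Fin n) F)
    (u : Finset (Fin n) → MvPolynomial (Fin n) F) (S : Finset (Fin n)) :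
    formAct g (fun S => p * u S) S = polyAct g p * formAct g u S := by
  simp_rw [formAct, map_mul, Finset.mul_sum, mul_assoc]

theorem formAct_sum {ι : Type*} (g : GLn F n) (T : Finset ι)
    (u : ι → Finset (Fin n) → MvPolynomial (Fin n) F) (S : Finset (Fin n)) :
    formAct g (fun S => ∑ i ∈ T, u i S) S = ∑ i ∈ T, formAct g (u i) S := by
  simp_rw [formAct, map_sum, Finset.sum_mul]
  exact Finset.sum_comm

section TwistedWedge

open Set

variable {ω : Fin n → Fin n → MvPolynomial (Fin n) F}
  {d : MvPolynomial (Fin n) F} {W : Finset (Fin n) → Finset (Fin n) → MvPolynomial (Fin n) F}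

theorem twistedWedge_of_card_ne (hd : d ≠ 0)
    (hW : ∀ I S, d ^ (I.card - 1) * W I S =
      iterWedge ((I.sort (· ≤ ·)).map fun i => oneToForm (ω i)) S)
    {I S : Finset (Fin n)} (h : S.card ≠ I.card) : W I S = 0 := by
  have h1 := hW I S
  rw [iterWedge_sort_of_card_ne ω h] at h1
  exact (mul_eq_zero.mp h1).resolve_left (pow_ne_zero _ hd)

theorem formAct_twistedWedge (hd : d ≠ 0)
    (hW : ∀ I S, d ^ (I.card - 1) * W I S =
      iterWedge ((I.sort (· ≤ ·)).map fun i => oneToForm (ω i)) S)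
    {g : GLn F n} (hω : ∀ i, oneFormAct g (ω i) = ω i)
    (hdg : polyAct g d = d) (I : Finset (Fin n)) : formAct g (W I) = W I := by
  funext S
  by_cases hS : S.card = I.card
  · have h1 := formAct_iterWedge hω hS
    rw [← hW I S, ← funext (hW I), formAct_mul, map_pow, hdg] at h1
    exact mul_left_cancel₀ (pow_ne_zero _ hd) h1
  · rw [twistedWedge_of_card_ne hd hW hS]
    exact formAct_of_forall_card_ne (fun S hS => twistedWedge_of_card_ne hd hW hS) hS

theorem pow_mul_sum_mul_twistedWedge
    (hW : ∀ I S, d ^ (I.card - 1) * W I S =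
      iterWedge ((I.sort (· ≤ ·)).map fun i => oneToForm (ω i)) S)
    {k : ℕ} (h : Finset (Fin n) → MvPolynomial (Fin n) F)
    (S : powersetCard (Fin n) k) :
    d ^ (k - 1) * ∑ I ∈ Finset.univ.filter (fun I : Finset (Fin n) => I.card = k),
      h I * W I S = ∑ t : powersetCard (Fin n) k, h t.1 *
        (Matrix.of fun a b => Matrix.of ω (t.1.orderEmbOfFin t.2 a)
          (S.1.orderEmbOfFin S.2 b)).det := by
  classical
  have hs : ∀ x : Finset (Fin n), x ∈ Finset.univ.filter (fun I : Finset (Fin n) => I.card = k) ↔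
      x ∈ powersetCard (Fin n) k := fun x => by simp
  rw [Finset.sum_subtype _ hs, Finset.mul_sum]
  refine Finset.sum_congr rfl fun t _ => ?_
  have h1 := hW t.1 S.1
  rw [iterWedge_sort ω t.2 S.2, show t.1.card = k from t.2] at h1
  rw [mul_left_comm, h1]
  rfl

theorem eq_zero_of_sum_mul_twistedWedge_eq_zero
    (hW : ∀ I S, d ^ (I.card - 1) * W I S =
      iterWedge ((I.sort (· ≤ ·)).map fun i => oneToForm (ω i)) S)
    (hM : (Matrix.of ω).det ≠ 0) {k : ℕ}
    {h : Finset (Fin n) → MvPolynomial (Fin n) F}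
    (hS : ∀ S, ∑ I ∈ Finset.univ.filter (fun I : Finset (Fin n) => I.card = k),
      h I * W I S = 0) {I : Finset (Fin n)} (hI : I.card = k) : h I = 0 :=
  eq_zero_of_sum_mul_minor_eq_zero hM (fun S => by
    rw [← pow_mul_sum_mul_twistedWedge hW, hS, mul_zero]) (⟨I, hI⟩ : powersetCard (Fin n) k)

theorem eq_sum_mul_twistedWedge (hd : d ≠ 0)
    (hW : ∀ I S, d ^ (I.card - 1) * W I S =
      iterWedge ((I.sort (· ≤ ·)).map fun i => oneToForm (ω i)) S)
    (hM : (Matrix.of ω).det ≠ 0) {k : ℕ}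
    {u h : Finset (Fin n) → MvPolynomial (Fin n) F} (hu : ∀ S, S.card ≠ k → u S = 0)
    (hh : ∀ t : powersetCard (Fin n) k,
      evalForm (MvPolynomial (Fin n) F) u k
        (fun a i => (Matrix.of ω).adjugate i (t.1.orderEmbOfFin t.2 a)) * d ^ (k - 1) =
          (Matrix.of ω).det ^ k * h t.1) (S : Finset (Fin n)) :
    u S = ∑ I ∈ Finset.univ.filter (fun I : Finset (Fin n) => I.card = k), h I * W I S := by
  by_cases hS : S.card = k
  · have h1 := sum_minor_mul_evalForm_adjugate (k := k) (Matrix.of ω) u ⟨S, hS⟩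
    refine mul_left_cancel₀ (mul_ne_zero (pow_ne_zero k hM) (pow_ne_zero (k - 1) hd)) ?_
    rw [mul_assoc _ _ (Finset.sum _ _), pow_mul_sum_mul_twistedWedge hW h ⟨S, hS⟩,
      mul_right_comm, ← h1, Finset.sum_mul, Finset.mul_sum]
    refine Finset.sum_congr rfl fun t _ => ?_
    rw [← mul_assoc, ← hh t]
    ring
  · rw [hu S hS]
    refine (Finset.sum_eq_zero fun I hI => ?_).symm
    rw [twistedWedge_of_card_ne hd hW (by rwa [(Finset.mem_filter.mp hI).2]), mul_zero]

end TwistedWedge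

/-- if `G` has polynomial invariants, every transvection root space is
maximal (`b_H = n-1` for all `H ∈ A`), and `ω₁ ∧ ⋯ ∧ ωₙ ≐ Q(Ã)·Q_det·vol`, then the
twisted wedges `ω_I = (ω_{i₁} ∧ ⋯ ∧ ω_{i_k})/δ(A_{n-1})^{k-1}` are invariant forms and
form a basis of `(Ω^k)^G` as a free `F[V]^G`-module; hence `Ω^G` is a free exterior
algebra on `ω₁,…,ωₙ` under the twisted wedge `(μ,ν) ↦ (μ ∧ ν)/δ(A_{n-1})`. -/
theorem stmt10 {F : Type*} [Field F] (h2 : ringChar F ≠ 2) {n : ℕ}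
    (G : Subgroup (GLn F n)) [Finite G]
    (hpoly : ∃ f : Fin n → MvPolynomial (Fin n) F, (∀ i, f i ∈ invSub G) ∧
      AlgebraicIndependent F f ∧ Algebra.adjoin F (Set.range f) = invSub G)
    (A : Finset (Submodule F (Fin n → F)))
    (hA : ∀ H, H ∈ A ↔ ∃ g ∈ G, IsReflection g ∧ fixedSpace g = H)
    (hb : ∀ H ∈ A, bH G H = n - 1)
    (ℓ : Submodule F (Fin n → F) → ((Fin n → F) →ₗ[F] F))
    (hℓ : ∀ H ∈ A, ℓ H ≠ 0 ∧ LinearMap.ker (ℓ H) = H)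
    (ω : Fin n → Fin n → MvPolynomial (Fin n) F)
    (hω : ∀ i, ∀ g ∈ G, oneFormAct g (ω i) = ω i)
    (c : F) (hc : c ≠ 0)
    (hdet : Matrix.det (Matrix.of fun i j => ω i j) =
      C c * ∏ H ∈ A, linToPoly (ℓ H) ^ (eH G H * bH G H + eH G H - 1))
    -- `W I` is the twisted wedge `ω_I`, i.e. the wedge of the `ω_i`, `i ∈ I`, divided
    -- by `δ(A_{n-1})^{|I|-1}` where `δ(A_{n-1}) = ∏_{H : b_H = n-1} l_H^{e_H}`:
    (W : Finset (Fin n) → (Finset (Fin n) → MvPolynomial (Fin n) F))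
    (hW : ∀ I : Finset (Fin n), ∀ S : Finset (Fin n),
      (∏ H ∈ A, linToPoly (ℓ H) ^ eH G H) ^ (I.card - 1) * W I S =
        iterWedge ((I.sort (· ≤ ·)).map fun i => oneToForm (ω i)) S) :
    (∀ I : Finset (Fin n), ∀ g ∈ G, formAct g (W I) = W I) ∧
    ∀ (k : ℕ) (u : Finset (Fin n) → MvPolynomial (Fin n) F),
      (∀ g ∈ G, formAct g u = u) → (∀ S, S.card ≠ k → u S = 0) →
      ∃! h : Finset (Fin n) → MvPolynomial (Fin n) F,
        (∀ I, h I ∈ invSub G) ∧ (∀ I, I.card ≠ k → h I = 0) ∧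
        ∀ S, u S = ∑ I ∈ Finset.univ.filter (fun I : Finset (Fin n) => I.card = k),
          h I * W I S := by
  have hd := prod_linToPoly_pow_ne_zero hℓ (eH G)
  have hM : (Matrix.of ω).det ≠ 0 := by
    refine hdet.trans_ne (mul_ne_zero ?_ (prod_linToPoly_pow_ne_zero hℓ _))
    rwa [Ne, C_eq_zero]
  have hWinv : ∀ I : Finset (Fin n), ∀ g ∈ G, formAct g (W I) = W I := fun I g hg =>
    formAct_twistedWedge hd hW (fun i => hω i g hg)
      (polyAct_prod_linToPoly_pow_eH hpoly hA hℓ hg) I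
  refine ⟨hWinv, fun k u hu huk => ?_⟩
  have huniq : ∀ h h' : Finset (Fin n) → MvPolynomial (Fin n) F,
      (∀ S, u S = ∑ I ∈ Finset.univ.filter (fun I : Finset (Fin n) => I.card = k),
        h I * W I S) →
      (∀ S, u S = ∑ I ∈ Finset.univ.filter (fun I : Finset (Fin n) => I.card = k),
        h' I * W I S) → ∀ I : Finset (Fin n), I.card = k → h I = h' I :=
    fun h h' hh hh' I hI => sub_eq_zero.mp <|
      eq_zero_of_sum_mul_twistedWedge_eq_zero (h := fun I => h I - h' I) hW hM (fun S => by
        simp_rw [sub_mul]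
        rw [Finset.sum_sub_distrib, ← hh, ← hh', sub_self]) hI
  choose q hq using fun t : Set.powersetCard (Fin n) k =>
    det_pow_dvd_evalForm_adjugate hb hℓ hω hc hdet hu (t.1.orderEmbOfFin t.2)
  classical
  let h : Finset (Fin n) → MvPolynomial (Fin n) F := fun I =>
    if hI : I.card = k then q ⟨I, hI⟩ else 0
  have hk : ∀ I : Finset (Fin n), I.card ≠ k → h I = 0 := fun I hI => dif_neg hI
  have hsum := eq_sum_mul_twistedWedge (h := h) hd hW hM huk fun t => by
    rw [hq t]
    congr 1
    have h1 : h t.1 = q t := dif_pos (show t.1.card = k from t.2)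
    exact h1.symm
  refine ⟨h, ⟨fun I g hg => ?_, hk, hsum⟩, fun h' hh' => funext fun I => ?_⟩
  · by_cases hI : I.card = k
    · refine huniq (fun I => polyAct g (h I)) h (fun S => ?_) hsum I hI
      conv_lhs => rw [← hu g hg, funext hsum, formAct_sum]
      refine Finset.sum_congr rfl fun I _ => ?_
      rw [formAct_mul, hWinv I g hg]
    · rw [hk I hI, map_zero]
  · by_cases hI : I.card = k
    · exact huniq h' h hh'.2.2 hsum I hI
    · rw [hk I hI, hh'.2.1 I hI]
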